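/- Let Ω ⊂ P(ℝ^d) be a properly convex domain, let Λ ⊂ Aut(Ω) be a convex co-compact subgroup, and let C = C_Ω(Λ). Assume every boundary face of Ω which intersects closure(C) has dimension at most one. If ℓ ⊂ ∂_i C is a line segment, S ⊂ C is a properly embedded two-dimensional simplex, and ℓ ∩ ∂S ≠ ∅, then ℓ ⊂ ∂S. -/

import Mathlib

open Set Filter

noncomputable section

/-- Real projective space `P(ℝ^d)`, with the quotient topology. -/
abbrev PSpace (d : ℕ) := Projectivization ℝ (Fin d → ℝ)

instance PSpace.instTopologicalSpace (d : ℕ) : TopologicalSpace (PSpace d) :=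
  inferInstanceAs (TopologicalSpace (Quotient (projectivizationSetoid ℝ (Fin d → ℝ))))

namespace Paper

variable {d : ℕ}

/-- Inhomogeneous coordinates in the affine chart determined by the linear functional `f`:
a projective point `[v]` with `f v ≠ 0` is sent to the representative `v / f v` lying in the
affine hyperplane `{f = 1}`. -/
def chartMap (f : (Fin d → ℝ) →ₗ[ℝ] ℝ) (x : PSpace d) : Fin d → ℝ :=
  (f x.rep)⁻¹ • x.rep

/-- A subset of `P(ℝ^d)` is properly convex if there is an affine chart in which it is a
bounded convex set. -/
def IsProperlyConvex (C : Set (PSpace d)) : Prop :=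
  ∃ f : (Fin d → ℝ) →ₗ[ℝ] ℝ, (∀ x ∈ closure C, f x.rep ≠ 0) ∧
    Convex ℝ (chartMap f '' C) ∧ Bornology.IsBounded (chartMap f '' C)

/-- A properly convex domain: an open, nonempty, properly convex subset of `P(ℝ^d)`. -/
def IsPCDomain (Ω : Set (PSpace d)) : Prop :=
  IsOpen Ω ∧ Ω.Nonempty ∧ IsProperlyConvex Ω

open Classical in
/-- A choice of an affine chart containing the properly convex set `C`. -/
def chartOf (C : Set (PSpace d)) : (Fin d → ℝ) →ₗ[ℝ] ℝ :=
  if h : IsProperlyConvex C then h.choose else 0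

/-- The chart map associated to the chosen chart of `C`. -/
def cmap (C : Set (PSpace d)) : PSpace d → Fin d → ℝ := chartMap (chartOf C)

/-- The Hilbert distance between `u` and `v` computed in an affine chart where the convex set
is `O`: writing the line through `u, v` as `t ↦ u + t(v-u)`, with boundary parameters
`tm = inf {t | u + t(v-u) ∈ O} ≤ 0` and `tp = sup {...} ≥ 1`, the cross-ratio
`[a,u,v,b]` of `a = u + tm(v-u), u, v, b = u + tp(v-u)` equals `(tp(1-tm))/((-tm)(tp-1))`. -/
def hilbertDistChart (O : Set (Fin d → ℝ)) (u v : Fin d → ℝ) : ℝ :=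
  if u = v then 0
  else
    (1 / 2) * Real.log
      ((sSup {t : ℝ | u + t • (v - u) ∈ O} * (1 - sInf {t : ℝ | u + t • (v - u) ∈ O})) /
        ((-(sInf {t : ℝ | u + t • (v - u) ∈ O})) * (sSup {t : ℝ | u + t • (v - u) ∈ O} - 1)))

/-- The Hilbert metric of a properly convex set `C` (open in its span). -/
def hilbertDist (C : Set (PSpace d)) (x y : PSpace d) : ℝ :=
  hilbertDistChart (cmap C '' C) (cmap C x) (cmap C y)

/-- The closed projective line segment `[x,y]` contained in `closure C`. -/
def projSeg (C : Set (PSpace d)) (x y : PSpace d) : Set (PSpace d) :=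
  {z ∈ closure C | cmap C z ∈ segment ℝ (cmap C x) (cmap C y)}

/-- The open projective line segment `(x,y)` contained in `closure C`. -/
def projOpenSeg (C : Set (PSpace d)) (x y : PSpace d) : Set (PSpace d) :=
  {z ∈ closure C | cmap C z ∈ openSegment ℝ (cmap C x) (cmap C y)}

/-- The open face `F_C(x)` of a point `x ∈ closure C`: the set `{x}` together with all
`y ∈ closure C` such that some open line segment contained in `closure C` contains
both `x` and `y`. -/
def face (C : Set (PSpace d)) (x : PSpace d) : Set (PSpace d) :=
  insert x {y ∈ closure C | ∃ a ∈ closure C, ∃ b ∈ closure C,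
    x ∈ projOpenSeg C a b ∧ y ∈ projOpenSeg C a b}

/-- The ideal boundary `∂_i C = closure C \ C`. -/
def idealBdry (C : Set (PSpace d)) : Set (PSpace d) := closure C \ C

/-- The dimension of a subset `B`, computed in the chart of the ambient convex set `C`. -/
def pdimIn (C B : Set (PSpace d)) : ℕ :=
  Module.finrank ℝ (affineSpan ℝ (cmap C '' B)).direction

/-- The dimension of a convex subset of `P(ℝ^d)`. -/
def pdim (A : Set (PSpace d)) : ℕ := pdimIn A A

/-- The coarse dimension `cdim_C(A)` of a nonempty subset `A` of a properly convex set `C`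
open in its span: the smallest `k` such that `A` is contained in an `R`-neighborhood (for the
Hilbert metric of `C`) of a `k`-dimensional convex subset `B ⊆ C`. -/
def cdim (C A : Set (PSpace d)) : ℕ :=
  sInf {k : ℕ | ∃ R : ℝ, 0 < R ∧ ∃ B : Set (PSpace d), B ⊆ C ∧
    Convex ℝ (cmap C '' B) ∧ pdimIn C B = k ∧
    A ⊆ {p ∈ C | ∃ q ∈ B, hilbertDist C p q < R}}

/-- The cone over the standard open `(p-1)`-dimensional simplex: vectors whose first `p`
coordinates are positive and whose remaining coordinates vanish. -/
def simplexCone (p : ℕ) : Set (Fin d → ℝ) :=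
  {v | (∀ i : Fin d, (i : ℕ) < p → 0 < v i) ∧ ∀ i : Fin d, p ≤ (i : ℕ) → v i = 0}

/-- `S` is the image under `g ∈ PGL_d(ℝ)` of the standard open simplex with `p` vertices. -/
def IsSimplexWithMap (p : ℕ) (S : Set (PSpace d)) (g : (Fin d → ℝ) ≃ₗ[ℝ] (Fin d → ℝ)) : Prop :=
  S = {q : PSpace d | ∃ v ∈ simplexCone (d := d) p, ∃ hv : v ≠ 0,
        q = Projectivization.mk ℝ (g v) (by simpa using hv)}

/-- `S ⊆ P(ℝ^d)` is a simplex of dimension `k`. -/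
def IsSimplexOfDim (k : ℕ) (S : Set (PSpace d)) : Prop :=
  k + 1 ≤ d ∧ ∃ g : (Fin d → ℝ) ≃ₗ[ℝ] (Fin d → ℝ), IsSimplexWithMap (k + 1) S g

/-- `S` is a simplex with vertices `v 0, …, v (p-1)` (so of dimension `p - 1`). -/
def HasVertices {p : ℕ} (S : Set (PSpace d)) (v : Fin p → PSpace d) : Prop :=
  ∃ (hp : p ≤ d) (g : (Fin d → ℝ) ≃ₗ[ℝ] (Fin d → ℝ)),
    IsSimplexWithMap p S g ∧
    ∀ j : Fin p, v j = Projectivization.mk ℝ (g (Pi.single (Fin.castLE hp j) 1))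
      (by
        simp only [ne_eq, EmbeddingLike.map_eq_zero_iff]
        intro h
        have h1 := congrFun h (Fin.castLE hp j)
        rw [Pi.single_eq_same] at h1
        exact one_ne_zero (α := ℝ) h1)

/-- `A ⊆ B` is properly embedded if the inclusion map `A ↪ B` is proper. -/
def IsProperlyEmbedded (A B : Set (PSpace d)) : Prop :=
  ∃ h : A ⊆ B, IsProperMap (Set.inclusion h)

/-- The projective action of `GL(ℝ^d)` (hence of `PGL_d(ℝ)`) on `P(ℝ^d)`. -/
def pact (g : (Fin d → ℝ) ≃ₗ[ℝ] (Fin d → ℝ)) : PSpace d → PSpace d :=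
  Projectivization.map g.toLinearMap g.injective

/-- A naive convex co-compact triple `(Ω, C, Λ)`. -/
structure NCCTriple (d : ℕ) where
  Ω : Set (PSpace d)
  C : Set (PSpace d)
  Λ : Subgroup ((Fin d → ℝ) ≃ₗ[ℝ] (Fin d → ℝ))
  isOpen_Ω : IsOpen Ω
  nonempty_Ω : Ω.Nonempty
  properlyConvex_Ω : IsProperlyConvex Ω
  inv_Ω : ∀ g ∈ Λ, pact g '' Ω = Ω
  infinite_Λ : (Λ : Set ((Fin d → ℝ) ≃ₗ[ℝ] (Fin d → ℝ))).Infinite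
  discrete_Λ : ∀ K ⊆ Ω, IsCompact K →
    {g : (Fin d → ℝ) ≃ₗ[ℝ] (Fin d → ℝ) | g ∈ Λ ∧ (pact g '' K ∩ K).Nonempty}.Finite
  C_nonempty : C.Nonempty
  C_sub : C ⊆ Ω
  C_closedInΩ : closure C ∩ Ω ⊆ C
  C_convex : Convex ℝ (cmap Ω '' C)
  inv_C : ∀ g ∈ Λ, pact g '' C = C
  cocompact : ∃ K : Set (PSpace d), K ⊆ C ∧ IsCompact K ∧ C ⊆ ⋃ g ∈ Λ, pact g '' K

/-- The orbit of a point under a subgroup of `PGL_d(ℝ)`. -/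
def porbit (Λ : Subgroup ((Fin d → ℝ) ≃ₗ[ℝ] (Fin d → ℝ))) (p : PSpace d) : Set (PSpace d) :=
  {q | ∃ g ∈ Λ, q = pact g p}

/-- The full orbital limit set `L_Ω(Λ)`. -/
def limitSet (Ω : Set (PSpace d)) (Λ : Subgroup ((Fin d → ℝ) ≃ₗ[ℝ] (Fin d → ℝ))) :
    Set (PSpace d) :=
  ⋃ p ∈ Ω, (closure (porbit Λ p) \ porbit Λ p)

/-- The convex hull of `X ⊆ closure Ω` taken inside `Ω`. -/
def convHullIn (Ω X : Set (PSpace d)) : Set (PSpace d) :=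
  {z ∈ Ω | cmap Ω z ∈ convexHull ℝ (cmap Ω '' X)}

/-- `C_Ω(Λ)`: the convex hull of the full orbital limit set in `Ω`. -/
def coreC (Ω : Set (PSpace d)) (Λ : Subgroup ((Fin d → ℝ) ≃ₗ[ℝ] (Fin d → ℝ))) :
    Set (PSpace d) :=
  convHullIn Ω (limitSet Ω Λ)

/-- A convex co-compact group `Λ ⊆ Aut(Ω)`: an infinite discrete subgroup preserving `Ω`
such that `C_Ω(Λ)` is nonempty and `Λ` acts cocompactly on it. -/
structure CCSetup (d : ℕ) where
  Ω : Set (PSpace d)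
  Λ : Subgroup ((Fin d → ℝ) ≃ₗ[ℝ] (Fin d → ℝ))
  isOpen_Ω : IsOpen Ω
  nonempty_Ω : Ω.Nonempty
  properlyConvex_Ω : IsProperlyConvex Ω
  inv_Ω : ∀ g ∈ Λ, pact g '' Ω = Ω
  infinite_Λ : (Λ : Set ((Fin d → ℝ) ≃ₗ[ℝ] (Fin d → ℝ))).Infinite
  discrete_Λ : ∀ K ⊆ Ω, IsCompact K →
    {g : (Fin d → ℝ) ≃ₗ[ℝ] (Fin d → ℝ) | g ∈ Λ ∧ (pact g '' K ∩ K).Nonempty}.Finite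
  core_nonempty : (coreC Ω Λ).Nonempty
  cocompact : ∃ K : Set (PSpace d), K ⊆ coreC Ω Λ ∧ IsCompact K ∧
    coreC Ω Λ ⊆ ⋃ g ∈ Λ, pact g '' K

/-- The Gromov product of `x, y` at `w`, with respect to the Hilbert metric of `Ω`. -/
def gromovProd (Ω : Set (PSpace d)) (w x y : PSpace d) : ℝ :=
  (hilbertDist Ω x w + hilbertDist Ω y w - hilbertDist Ω x y) / 2

/-- `(C, d_Ω)` is Gromov hyperbolic. -/
def GromovHyperbolicOn (Ω C : Set (PSpace d)) : Prop :=
  ∃ δ : ℝ, 0 ≤ δ ∧ ∀ x ∈ C, ∀ y ∈ C, ∀ z ∈ C, ∀ w ∈ C,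
    min (gromovProd Ω w x y) (gromovProd Ω w y z) - δ ≤ gromovProd Ω w x z

/-- The open Hilbert-metric ball in `Ω`. -/
def hBall (Ω : Set (PSpace d)) (x : PSpace d) (r : ℝ) : Set (PSpace d) :=
  {y ∈ Ω | hilbertDist Ω x y < r}

/-- The Hausdorff distance between `A` and `B` (w.r.t. the Hilbert metric of `Ω`)
is less than `ε`. -/
def hausLT (Ω A B : Set (PSpace d)) (ε : ℝ) : Prop :=
  (∀ a ∈ A, ∃ b ∈ B, hilbertDist Ω a b < ε) ∧ ∀ b ∈ B, ∃ a ∈ A, hilbertDist Ω a b < ε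

/-- The Hausdorff distance between `A` and `B` (w.r.t. the Hilbert metric of `Ω`)
is at most `r`. -/
def hausdorffDistLE (Ω A B : Set (PSpace d)) (r : ℝ) : Prop :=
  ∀ ε : ℝ, 0 < ε → hausLT Ω A B (r + ε)

/-- Convergence `F n → C` in the local Hausdorff topology induced by `d_Ω`. -/
def LocalHausConv (Ω : Set (PSpace d)) (F : ℕ → Set (PSpace d)) (C : Set (PSpace d)) : Prop :=
  ∀ x ∈ Ω, ∀ r : ℝ, 0 < r → ∀ ε : ℝ, 0 < ε →
    ∀ᶠ n in atTop, hausLT Ω (F n ∩ hBall Ω x r) (C ∩ hBall Ω x r) ε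

/-- A collection `𝒮` of closed subsets of `Ω` is closed and discrete in the local Hausdorff
topology: any sequence in `𝒮` converging to a nonempty closed subset of `Ω` has limit in `𝒮`
and is eventually equal to its limit. -/
def ClosedAndDiscreteInLHT (Ω : Set (PSpace d)) (𝒮 : Set (Set (PSpace d))) : Prop :=
  ∀ F : ℕ → Set (PSpace d), (∀ n, F n ∈ 𝒮) →
    ∀ C : Set (PSpace d), C.Nonempty → C ⊆ Ω → closure C ∩ Ω ⊆ C → LocalHausConv Ω F C →
      C ∈ 𝒮 ∧ ∀ᶠ n in atTop, F n = C


structure Ab (d : ℕ) where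
  P : Set (Fin d → ℝ)
  Z : Set (Fin d → ℝ)
  Cc : Set (Fin d → ℝ)
  κ : Set (Fin d → ℝ)
  f : (Fin d → ℝ) →ₗ[ℝ] ℝ
  R : ℝ
  P_open : IsOpen P
  P_ne : P.Nonempty
  P_add : ∀ x ∈ P, ∀ y ∈ P, x + y ∈ P
  P_smul : ∀ c : ℝ, 0 < c → ∀ x ∈ P, c • x ∈ P
  P_bd : ∀ x ∈ P, ‖x‖ ≤ R * f x
  P_pos : ∀ x ∈ P, 0 < f x
  Z_closed : IsClosed Z
  Z_sub : Z ⊆ closure P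
  Z_add : ∀ x ∈ Z, ∀ y ∈ Z, x + y ∈ Z
  Z_smul : ∀ c : ℝ, 0 < c → ∀ x ∈ Z, c • x ∈ Z
  κ_cpt : IsCompact κ
  κ_sub : κ ⊆ P
  D : ∀ x ∈ Z, x ∉ P → ∀ w : Fin 3 → (Fin d → ℝ), LinearIndependent ℝ w →
    (∀ i, ∃ c : ℝ, 0 < c ∧ w i ∈ closure P ∧ x - c • w i ∈ closure P) → False
  zoom : ∀ x ∈ Cc, ∃ L : (Fin d → ℝ) →ₗ[ℝ] (Fin d → ℝ), (∀ v ∈ P, L v ∈ P) ∧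
    (∀ v ∈ closure P, v ∉ P → L v ∉ P) ∧ (∀ v ∈ Z, L v ∈ Z) ∧ L x ∈ κ

namespace Ab
variable {d : ℕ} (T : Ab d)

abbrev K : Set (Fin d → ℝ) := closure T.P

lemma K_closed : IsClosed T.K := isClosed_closure

lemma P_sub_K : T.P ⊆ T.K := subset_closure

lemma K_add_P {x p : Fin d → ℝ} (hx : x ∈ T.K) (hp : p ∈ T.P) : x + p ∈ T.P := by
  have hc : Continuous fun z : Fin d → ℝ => p + x - z := by fun_prop
  have ho : IsOpen ((fun z : Fin d → ℝ => p + x - z) ⁻¹' T.P) := T.P_open.preimage hc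
  have hm : x ∈ ((fun z : Fin d → ℝ => p + x - z) ⁻¹' T.P) := by simpa using hp
  obtain ⟨z, hz1, hz2⟩ := mem_closure_iff.1 hx _ ho hm
  have := T.P_add _ hz2 _ hz1
  have e : z + (p + x - z) = x + p := by abel
  rwa [e] at this

lemma K_add {x y : Fin d → ℝ} (hx : x ∈ T.K) (hy : y ∈ T.K) : x + y ∈ T.K :=
  map_mem_closure₂ (by fun_prop : Continuous fun p : (Fin d → ℝ) × (Fin d → ℝ) => p.1 + p.2)
    hx hy T.P_add

lemma K_smul_pos {c : ℝ} (hc : 0 < c) {x : Fin d → ℝ} (hx : x ∈ T.K) : c • x ∈ T.K :=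
  map_mem_closure (continuous_const_smul c) hx (T.P_smul c hc)

lemma K_zero : (0 : Fin d → ℝ) ∈ T.K := by
  obtain ⟨p, hp⟩ := T.P_ne
  have : Tendsto (fun n : ℕ => (1 / ((n : ℝ) + 1)) • p) atTop (nhds ((0 : ℝ) • p)) :=
    tendsto_one_div_add_atTop_nhds_zero_nat.smul_const p
  rw [zero_smul] at this
  exact mem_closure_of_tendsto this (Eventually.of_forall fun n => T.P_smul _ (by positivity) _ hp)

lemma K_smul {c : ℝ} (hc : 0 ≤ c) {x : Fin d → ℝ} (hx : x ∈ T.K) : c • x ∈ T.K := by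
  rcases hc.eq_or_lt with h | h
  · rw [← h, zero_smul]; exact T.K_zero
  · exact T.K_smul_pos h hx

lemma f_cont : Continuous T.f := T.f.continuous_of_finiteDimensional

lemma K_bd {x : Fin d → ℝ} (hx : x ∈ T.K) : ‖x‖ ≤ T.R * T.f x := by
  have hcl : IsClosed {x : Fin d → ℝ | ‖x‖ ≤ T.R * T.f x} :=
    isClosed_le continuous_norm (continuous_const.mul T.f_cont)
  exact closure_minimal T.P_bd hcl hx

lemma K_nonneg {x : Fin d → ℝ} (hx : x ∈ T.K) : 0 ≤ T.f x := by
  have hcl : IsClosed {x : Fin d → ℝ | 0 ≤ T.f x} := isClosed_le continuous_const T.f_cont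
  exact closure_minimal (fun x hx => (T.P_pos x hx).le) hcl hx

lemma K_eq_zero {x : Fin d → ℝ} (hx : x ∈ T.K) (h : T.f x = 0) : x = 0 := by
  have := T.K_bd hx
  rw [h, mul_zero] at this
  exact norm_le_zero_iff.1 this

lemma R_pos_aux {x : Fin d → ℝ} (hx : x ∈ T.K) {m : ℝ} (h : T.f x ≤ m) : ‖x‖ ≤ |T.R| * m :=
  calc ‖x‖ ≤ T.R * T.f x := T.K_bd hx
    _ ≤ |T.R| * T.f x := by gcongr; exact T.K_nonneg hx; exact le_abs_self _
    _ ≤ |T.R| * m := by gcongr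

lemma slab_cpt (m : ℝ) : IsCompact {x | x ∈ T.K ∧ T.f x ≤ m} := by
  apply Metric.isCompact_of_isClosed_isBounded
  · exact T.K_closed.inter (isClosed_le T.f_cont continuous_const)
  · rw [isBounded_iff_forall_norm_le]
    exact ⟨|T.R| * m, fun x hx => T.R_pos_aux hx.1 hx.2⟩

/-- no nonneg relation -/
lemma no_rel {V A B C : Fin d → ℝ} (hV : V ∈ T.K) (hB : B ∈ T.K) (hC : C ∈ T.K)
    (nA : ∀ s : ℝ, 0 ≤ s → V + s • A ∉ T.P) (nB : ∀ s : ℝ, 0 ≤ s → V + s • B ∉ T.P)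
    (nC : ∀ s : ℝ, 0 ≤ s → V + s • C ∉ T.P)
    (hAB : V + A + B ∈ T.P) (hAC : V + A + C ∈ T.P) (hBC : V + B + C ∈ T.P)
    {α β : ℝ} (hα : 0 ≤ α) (hβ : 0 ≤ β) (h : A = α • B + β • C) : False := by
  rcases hα.eq_or_lt with h0 | hα'
  · refine nC (β + 1) (by positivity) ?_
    convert hAC using 1
    rw [h, ← h0]; module
  rcases hβ.eq_or_lt with h0 | hβ'
  · refine nB (α + 1) (by positivity) ?_
    convert hAB using 1
    rw [h, ← h0]; module
  obtain ⟨μ, hμ, h1, h2, h3⟩ : ∃ μ : ℝ, 0 < μ ∧ μ ≤ 1 ∧ μ ≤ α ∧ μ ≤ β :=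
    ⟨min 1 (min α β), by positivity, by simp, by simp, by simp⟩
  refine nA 1 zero_le_one ?_
  have : ((1 - μ) • V + (α - μ) • B + (β - μ) • C) + μ • (V + B + C) ∈ T.P := by
    apply T.K_add_P _ (T.P_smul _ hμ _ hBC)
    exact T.K_add (T.K_add (T.K_smul (by linarith) hV) (T.K_smul (by linarith) hB))
      (T.K_smul (by linarith) hC)
  convert this using 1
  rw [h]; module

lemma no_rel' {V A B C : Fin d → ℝ} (hV : V ∈ T.K) (hB : B ∈ T.K) (hC : C ∈ T.K)
    (nA : ∀ s : ℝ, 0 ≤ s → V + s • A ∉ T.P) (nB : ∀ s : ℝ, 0 ≤ s → V + s • B ∉ T.P)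
    (nC : ∀ s : ℝ, 0 ≤ s → V + s • C ∉ T.P)
    (hAB : V + A + B ∈ T.P) (hAC : V + A + C ∈ T.P) (hBC : V + B + C ∈ T.P)
    {a b c : ℝ} (ha : 0 < a) (hb : b ≤ 0) (hc : c ≤ 0) (h : a • A + b • B + c • C = 0) :
    False := by
  refine T.no_rel hV hB hC nA nB nC hAB hAC hBC (α := -b / a) (β := -c / a)
    (div_nonneg (by linarith) ha.le) (div_nonneg (by linarith) ha.le) ?_
  have h2 : a • A = (-b) • B + (-c) • C := by
    rw [← sub_eq_zero, ← h]; module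
  calc A = a⁻¹ • (a • A) := by rw [smul_smul, inv_mul_cancel₀ ha.ne', one_smul]
    _ = _ := by rw [h2]; module

lemma no_rel_pos {A B C : Fin d → ℝ} (hA : A ∈ T.K) (hB : B ∈ T.K) (hC : C ∈ T.K)
    {a b c : ℝ} (ha : 0 < a) (hb : 0 ≤ b) (hc : 0 ≤ c) (h : a • A + b • B + c • C = 0) :
    A = 0 := by
  apply T.K_eq_zero hA
  have := congrArg T.f h
  simp only [map_add, map_smul, smul_eq_mul, map_zero] at this
  have h1 := T.K_nonneg hA
  have h2 := mul_nonneg hb (T.K_nonneg hB)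
  have h3 := mul_nonneg hc (T.K_nonneg hC)
  have h4 := mul_nonneg ha.le h1
  have : a * T.f A = 0 := by linarith
  rcases mul_eq_zero.1 this with h | h
  · exact absurd h ha.ne'
  · exact h

lemma indep {V A B C : Fin d → ℝ} (hV : V ∈ T.K) (hA : A ∈ T.K) (hB : B ∈ T.K) (hC : C ∈ T.K)
    (nA : ∀ s : ℝ, 0 ≤ s → V + s • A ∉ T.P) (nB : ∀ s : ℝ, 0 ≤ s → V + s • B ∉ T.P)
    (nC : ∀ s : ℝ, 0 ≤ s → V + s • C ∉ T.P)
    (hAB : V + A + B ∈ T.P) (hAC : V + A + C ∈ T.P) (hBC : V + B + C ∈ T.P) :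
    LinearIndependent ℝ ![A, B, C] := by
  have hBA : V + B + A ∈ T.P := by convert hAB using 1; abel
  have hCA : V + C + A ∈ T.P := by convert hAC using 1; abel
  have hCB : V + C + B ∈ T.P := by convert hBC using 1; abel
  -- positive first coefficient impossible, for all orderings
  have key : ∀ {A B C : Fin d → ℝ} (_ : A ∈ T.K) (_ : B ∈ T.K) (_ : C ∈ T.K)
    (_ : ∀ s : ℝ, 0 ≤ s → V + s • A ∉ T.P) (_ : ∀ s : ℝ, 0 ≤ s → V + s • B ∉ T.P)
    (_ : ∀ s : ℝ, 0 ≤ s → V + s • C ∉ T.P)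
    (_ : V + A + B ∈ T.P) (_ : V + A + C ∈ T.P) (_ : V + B + C ∈ T.P)
    (_ : V + B + A ∈ T.P) (_ : V + C + A ∈ T.P) (_ : V + C + B ∈ T.P)
    (a b c : ℝ) (_ : 0 < a) (_ : a • A + b • B + c • C = 0), False := by
    intro A B C hA hB hC nA nB nC hAB hAC hBC hBA hCA hCB a b c ha h
    rcases le_or_gt b 0 with hb | hb
    · rcases le_or_gt c 0 with hc | hc
      · exact T.no_rel' hV hB hC nA nB nC hAB hAC hBC ha hb hc h
      · rcases hb.eq_or_lt with hb' | hb'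
        · have h0 := T.no_rel_pos hA hB hC ha hb'.ge hc.le h
          exact T.no_rel hV hB hC nA nB nC hAB hAC hBC le_rfl le_rfl (by simpa using h0)
        · exact T.no_rel' hV hA hC nB nA nC hBA hBC hAC (a := -b) (b := -a) (c := -c)
            (by linarith) (by linarith) (by linarith) (by rw [← neg_zero, ← h]; module)
    · rcases le_or_gt 0 c with hc | hc
      · have h0 := T.no_rel_pos hA hB hC ha hb.le hc h
        exact T.no_rel hV hB hC nA nB nC hAB hAC hBC le_rfl le_rfl (by simpa using h0)
      · exact T.no_rel' hV hA hB nC nA nB hCA hCB hAB (a := -c) (b := -a) (c := -b)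
            (by linarith) (by linarith) (by linarith) (by rw [← neg_zero, ← h]; module)
  have key' : ∀ {A B C : Fin d → ℝ} (_ : A ∈ T.K) (_ : B ∈ T.K) (_ : C ∈ T.K)
    (_ : ∀ s : ℝ, 0 ≤ s → V + s • A ∉ T.P) (_ : ∀ s : ℝ, 0 ≤ s → V + s • B ∉ T.P)
    (_ : ∀ s : ℝ, 0 ≤ s → V + s • C ∉ T.P)
    (_ : V + A + B ∈ T.P) (_ : V + A + C ∈ T.P) (_ : V + B + C ∈ T.P)
    (_ : V + B + A ∈ T.P) (_ : V + C + A ∈ T.P) (_ : V + C + B ∈ T.P)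
    (a b c : ℝ) (_ : a • A + b • B + c • C = 0), a = 0 := by
    intro A B C hA hB hC nA nB nC hAB hAC hBC hBA hCA hCB a b c h
    rcases lt_trichotomy a 0 with ha | ha | ha
    · exact (key hA hB hC nA nB nC hAB hAC hBC hBA hCA hCB (-a) (-b) (-c) (by linarith)
        (by rw [← neg_zero, ← h]; module)).elim
    · exact ha
    · exact (key hA hB hC nA nB nC hAB hAC hBC hBA hCA hCB a b c ha h).elim
  rw [Fintype.linearIndependent_iff]
  intro g hg
  simp only [Fin.sum_univ_three, Matrix.cons_val_zero, Matrix.cons_val_one, Matrix.cons_val] at hg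
  intro i
  fin_cases i
  · exact key' hA hB hC nA nB nC hAB hAC hBC hBA hCA hCB _ _ _ hg
  · exact key' hB hA hC nB nA nC hBA hBC hAC hAB hCB hCA (g 1) (g 0) (g 2)
      (by rw [← hg]; module)
  · exact key' hC hA hB nC nA nB hCA hCB hAB hAC hBC hBA (g 2) (g 0) (g 1)
      (by rw [← hg]; module)

lemma exists_eps {p w : Fin d → ℝ} (hp : p ∈ T.P) : ∃ ε : ℝ, 0 < ε ∧ ε ≤ 1 ∧ p - ε • w ∈ T.P := by
  have ht : Tendsto (fun n : ℕ => p - (1 / ((n : ℝ) + 1)) • w) atTop (nhds (p - (0 : ℝ) • w)) :=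
    tendsto_const_nhds.sub (tendsto_one_div_add_atTop_nhds_zero_nat.smul_const w)
  rw [zero_smul, sub_zero] at ht
  obtain ⟨n, hn⟩ := (ht.eventually (T.P_open.mem_nhds hp)).exists
  refine ⟨_, ?_, ?_, hn⟩
  · positivity
  · rw [div_le_one (by positivity)]; linarith [(Nat.cast_nonneg n : (0:ℝ) ≤ n)]

/-- the zooming argument -/
lemma zoom_false {v1 v2 v3 q : Fin d → ℝ}
    (h1 : v1 ∈ T.K) (h2 : v2 ∈ T.K) (h3 : v3 ∈ T.K) (hq : q ∈ T.K)
    (h23 : v2 + v3 ∈ T.Z) (n23 : v2 + v3 ∉ T.P)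
    (hCc : ∀ t : ℝ, 0 < t → v1 + t • (v2 + v3) ∈ T.Cc)
    (p3 : v1 + v2 + v3 ∈ T.P) (pq2 : v1 + v2 + q ∈ T.P) (pq3 : v1 + v3 + q ∈ T.P)
    (n2 : ∀ s : ℝ, 0 ≤ s → v1 + s • v2 ∉ T.P) (n3 : ∀ s : ℝ, 0 ≤ s → v1 + s • v3 ∉ T.P)
    (nq : ∀ s : ℝ, 0 ≤ s → v1 + s • q ∉ T.P) : False := by
  let t : ℕ → ℝ := fun n => 1 / ((n : ℝ) + 1)
  have tpos : ∀ n, 0 < t n := fun n => by positivity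
  have tle : ∀ n, t n ≤ 1 := fun n => by
    show 1 / ((n : ℝ) + 1) ≤ 1
    rw [div_le_one (by positivity)]; linarith [(Nat.cast_nonneg n : (0:ℝ) ≤ n)]
  have tlim : Tendsto t atTop (nhds 0) := tendsto_one_div_add_atTop_nhds_zero_nat
  choose L LP Ln LZ Lκ using fun n => T.zoom _ (hCc (t n) (tpos n))
  have LK : ∀ n, ∀ v ∈ T.K, L n v ∈ T.K := fun n v hv =>
    map_mem_closure (L n).continuous_of_finiteDimensional hv (LP n)
  obtain ⟨ε, εpos, εle, hε⟩ := T.exists_eps (w := q) p3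
  obtain ⟨m, hm⟩ : ∃ m : ℝ, ∀ x ∈ T.κ, T.f x ≤ m := by
    obtain ⟨m, hm⟩ := (T.κ_cpt.image T.f_cont).bddAbove
    exact ⟨m, fun x hx => hm ⟨x, hx, rfl⟩⟩
  have fx : ∀ n, T.f (L n v1) + t n * T.f (L n v2) + t n * T.f (L n v3) ≤ m := by
    intro n
    have := hm _ (Lκ n)
    simp only [map_add, map_smul, smul_eq_mul] at this
    linarith
  have f1 := fun n => T.K_nonneg (LK n _ h1)
  have f2 := fun n => mul_nonneg (tpos n).le (T.K_nonneg (LK n _ h2))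
  have f3 := fun n => mul_nonneg (tpos n).le (T.K_nonneg (LK n _ h3))
  have fq : ∀ n, t n * T.f (L n q) ≤ m / ε := by
    intro n
    have h0 := T.K_nonneg (LK n _ (T.P_sub_K hε))
    simp only [map_add, map_sub, map_smul, smul_eq_mul] at h0
    have h4 := mul_nonneg (tpos n).le h0
    have h5 : t n * T.f (L n v1) ≤ T.f (L n v1) := mul_le_of_le_one_left (f1 n) (tle n)
    rw [le_div_iff₀ εpos]
    nlinarith [fx n]
  let s : ℕ → (Fin d → ℝ) × (Fin d → ℝ) × (Fin d → ℝ) × (Fin d → ℝ) := fun n =>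
    (L n v1, t n • L n v2, t n • L n v3, t n • L n q)
  have hs : ∀ n, s n ∈ {x | x ∈ T.K ∧ T.f x ≤ m} ×ˢ {x | x ∈ T.K ∧ T.f x ≤ m} ×ˢ
      {x | x ∈ T.K ∧ T.f x ≤ m} ×ˢ {x | x ∈ T.K ∧ T.f x ≤ m / ε} := by
    intro n
    refine ⟨⟨LK n _ h1, ?_⟩, ⟨T.K_smul (tpos n).le (LK n _ h2), ?_⟩,
      ⟨T.K_smul (tpos n).le (LK n _ h3), ?_⟩, ⟨T.K_smul (tpos n).le (LK n _ hq), ?_⟩⟩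
    · show T.f (L n v1) ≤ m
      linarith [fx n, f1 n, f2 n, f3 n]
    · show T.f (t n • L n v2) ≤ m
      rw [map_smul, smul_eq_mul]
      linarith [fx n, f1 n, f2 n, f3 n]
    · show T.f (t n • L n v3) ≤ m
      rw [map_smul, smul_eq_mul]
      linarith [fx n, f1 n, f2 n, f3 n]
    · show T.f (t n • L n q) ≤ m / ε
      rw [map_smul, smul_eq_mul]
      exact fq n
  obtain ⟨⟨V, U2, U3, Q⟩, -, φ, hφ, hlim⟩ := ((T.slab_cpt m).prod ((T.slab_cpt m).prod
    ((T.slab_cpt m).prod (T.slab_cpt (m / ε))))).tendsto_subseq hs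
  have l1 : Tendsto (fun n => L (φ n) v1) atTop (nhds V) :=
    ((continuous_fst.tendsto _).comp hlim)
  have l2 : Tendsto (fun n => t (φ n) • L (φ n) v2) atTop (nhds U2) :=
    (((continuous_fst.comp continuous_snd).tendsto _).comp hlim)
  have l3 : Tendsto (fun n => t (φ n) • L (φ n) v3) atTop (nhds U3) :=
    (((continuous_fst.comp (continuous_snd.comp continuous_snd)).tendsto _).comp hlim)
  have lq : Tendsto (fun n => t (φ n) • L (φ n) q) atTop (nhds Q) :=
    (((continuous_snd.comp (continuous_snd.comp continuous_snd)).tendsto _).comp hlim)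
  have lt : Tendsto (fun n => t (φ n)) atTop (nhds 0) := tlim.comp hφ.tendsto_atTop
  have hV : V ∈ T.K := T.K_closed.mem_of_tendsto l1 (Eventually.of_forall fun n => LK _ _ h1)
  have hU2 : U2 ∈ T.K := T.K_closed.mem_of_tendsto l2
    (Eventually.of_forall fun n => T.K_smul (tpos _).le (LK _ _ h2))
  have hU3 : U3 ∈ T.K := T.K_closed.mem_of_tendsto l3
    (Eventually.of_forall fun n => T.K_smul (tpos _).le (LK _ _ h3))
  have hQ : Q ∈ T.K := T.K_closed.mem_of_tendsto lq
    (Eventually.of_forall fun n => T.K_smul (tpos _).le (LK _ _ hq))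
  have hX : V + U2 + U3 ∈ T.P := by
    apply T.κ_sub
    refine T.κ_cpt.isClosed.mem_of_tendsto ((l1.add l2).add l3) (Eventually.of_forall fun n => ?_)
    have := Lκ (φ n)
    simp only [map_add, map_smul, smul_add] at this
    rwa [← add_assoc] at this
  have notP : ∀ {u : ℕ → Fin d → ℝ} {x : Fin d → ℝ}, Tendsto u atTop (nhds x) →
      (∀ n, u n ∉ T.P) → x ∉ T.P := fun hu hn =>
    T.P_open.isClosed_compl.mem_of_tendsto hu (Eventually.of_forall hn)
  have nU : ∀ {w U : Fin d → ℝ}, w ∈ T.K → (∀ s : ℝ, 0 ≤ s → v1 + s • w ∉ T.P) →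
      Tendsto (fun n => t (φ n) • L (φ n) w) atTop (nhds U) → ∀ s : ℝ, 0 ≤ s → V + s • U ∉ T.P := by
    intro w U hw hn hl s hs
    refine notP (l1.add (hl.const_smul s)) fun n => ?_
    have := Ln (φ n) (v1 + (s * t (φ n)) • w)
      (T.K_add h1 (T.K_smul (mul_nonneg hs (tpos _).le) hw)) (hn _ (mul_nonneg hs (tpos _).le))
    simpa only [map_add, map_smul, mul_smul] using this
  have limK : ∀ a b c : ℝ, v1 + a • v2 + b • v3 + c • q ∈ T.K →
      a • U2 + b • U3 + c • Q ∈ T.K := by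
    intro a b c h
    have hl := (((lt.smul l1).add (l2.const_smul a)).add (l3.const_smul b)).add (lq.const_smul c)
    rw [zero_smul, zero_add] at hl
    refine T.K_closed.mem_of_tendsto hl (Eventually.of_forall fun n => ?_)
    have := T.K_smul (tpos (φ n)).le (LK (φ n) _ h)
    convert this using 1
    simp only [map_add, map_smul]
    module
  have nM : U2 + U3 ∉ T.P := by
    refine notP (l2.add l3) fun n => ?_
    have := Ln (φ n) (t (φ n) • (v2 + v3)) (T.K_smul (tpos _).le (T.K_add h2 h3)) (fun h => n23 (by
      have := T.P_smul (t (φ n))⁻¹ (inv_pos.2 (tpos _)) _ h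
      rwa [smul_smul, inv_mul_cancel₀ (tpos _).ne', one_smul] at this))
    simpa only [map_add, map_smul, smul_add] using this
  have hM : U2 + U3 ∈ T.Z := by
    refine T.Z_closed.mem_of_tendsto (l2.add l3) (Eventually.of_forall fun n => ?_)
    have := T.Z_smul _ (tpos (φ n)) _ (LZ (φ n) _ h23)
    simpa only [map_add, smul_add] using this
  have hX2 : V + U2 + Q ∈ T.P := by
    obtain ⟨e, epos, ele, he⟩ := T.exists_eps (w := v2 + v3) pq2
    have := limK (1 - e) (-e) 1 (by convert T.P_sub_K he using 1; module)
    have := T.K_add_P (T.K_add (T.K_smul (sub_nonneg.2 ele) hV) this) (T.P_smul e epos _ hX)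
    convert this using 1; module
  have hX3 : V + U3 + Q ∈ T.P := by
    obtain ⟨e, epos, ele, he⟩ := T.exists_eps (w := v2 + v3) pq3
    have := limK (-e) (1 - e) 1 (by convert T.P_sub_K he using 1; module)
    have := T.K_add_P (T.K_add (T.K_smul (sub_nonneg.2 ele) hV) this) (T.P_smul e epos _ hX)
    convert this using 1; module
  have hind := T.indep hV hU2 hU3 hQ (nU h2 n2 l2) (nU h3 n3 l3) (nU hq nq lq) hX hX2 hX3
  refine T.D _ hM nM _ hind fun i => ?_
  fin_cases i
  · exact ⟨1, one_pos, hU2, by simpa using hU3⟩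
  · exact ⟨1, one_pos, hU3, by simpa using hU2⟩
  · refine ⟨ε, εpos, hQ, ?_⟩
    have := limK 1 1 (-ε) (by convert T.P_sub_K hε using 1; module)
    convert this using 1
    simp; module

lemma main {v : Fin 3 → (Fin d → ℝ)} (hv : LinearIndependent ℝ v)
    (hCc : ∀ c : Fin 3 → ℝ, (∀ i, 0 < c i) → ∑ i, c i • v i ∈ T.Cc)
    (hP : ∀ c : Fin 3 → ℝ, (∀ i, 0 < c i) → ∑ i, c i • v i ∈ T.P)
    (hZ : ∀ c : Fin 3 → ℝ, (∀ i, 0 ≤ c i) → (∃ i, 0 < c i) → ∑ i, c i • v i ∈ T.Z)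
    (hB : ∀ c : Fin 3 → ℝ, (∀ i, 0 ≤ c i) → (∃ i, c i = 0) → ∑ i, c i • v i ∉ T.P)
    {y q : Fin d → ℝ} (hy : ∃ c : Fin 3 → ℝ, (∀ i, 0 ≤ c i) ∧ (∃ i, 0 < c i) ∧ ∑ i, c i • v i = y)
    (hyq : ∀ s t : ℝ, 0 ≤ s → 0 ≤ t → 0 < s + t → s • y + t • q ∈ T.Z ∧ s • y + t • q ∉ T.P) :
    ∃ c : Fin 3 → ℝ, (∀ i, 0 ≤ c i) ∧ (∃ i, c i = 0) ∧ ∑ i, c i • v i = q := by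
  classical
  have vK : ∀ i, v i ∈ T.K := fun i => T.Z_sub (by
    have := hZ (Pi.single i 1) (fun j => by by_cases h : j = i <;> simp [Pi.single_apply, h])
      ⟨i, by simp⟩
    simpa [Pi.single_apply] using this)
  have hqZ : q ∈ T.Z ∧ q ∉ T.P := by simpa using hyq 0 1 le_rfl zero_le_one (by norm_num)
  have hqK : q ∈ T.K := T.Z_sub hqZ.1
  have sumK : ∀ (s : Finset (Fin 3)) (c : Fin 3 → ℝ), (∀ i ∈ s, 0 ≤ c i) →
      ∑ i ∈ s, c i • v i ∈ T.K := by
    intro s c hc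
    exact Finset.sum_induction _ (· ∈ T.K) (fun _ _ => T.K_add) T.K_zero
      (fun i hi => T.K_smul (hc i hi) (vK i))
  by_cases hspan : ∃ c : Fin 3 → ℝ, ∑ i, c i • v i = q
  · obtain ⟨a, ha⟩ := hspan
    have hpos : ∀ i, 0 ≤ a i := by
      by_contra hcon
      push Not at hcon
      obtain ⟨i, hi⟩ := hcon
      -- x = q + ∑ e_j v_j with e_i = - a_i, e_j = a_j^- + 1
      let e : Fin 3 → ℝ := fun j => if j = i then - a i else max (- a j) 0 + 1
      have epos : ∀ j, 0 < e j := by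
        intro j
        by_cases h : j = i
        · simp only [e, h, if_true]; linarith
        · simp only [e, h, if_false]; positivity
      have hx : ∀ j, 0 ≤ a j + e j := by
        intro j
        by_cases h : j = i
        · simp only [e, h, if_true]; linarith
        · simp only [e, h, if_false]
          linarith [le_max_left (-a j) 0]
      have hxi : a i + e i = 0 := by simp [e]
      have hxp : ∃ j, 0 < a j + e j := by
        obtain ⟨j, hj⟩ : ∃ j : Fin 3, j ≠ i := exists_ne i
        refine ⟨j, ?_⟩
        simp only [e, hj, if_false]
        linarith [le_max_left (-a j) 0]
      have hxs : ∑ j, (a j + e j) • v j = q + ∑ j, e j • v j := by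
        rw [← ha, ← Finset.sum_add_distrib]
        simp only [add_smul]
      refine T.D _ (hZ _ hx hxp) (hB _ hx ⟨i, hxi⟩) v hv fun j => ⟨e j, epos j, vK j, ?_⟩
      rw [hxs, ← Finset.add_sum_erase _ _ (Finset.mem_univ j)]
      have := T.K_add hqK (sumK (Finset.univ.erase j) e fun k _ => (epos k).le)
      convert this using 1
      abel
    refine ⟨a, hpos, ?_, ha⟩
    by_contra hcon
    push Not at hcon
    exact hqZ.2 (ha ▸ hP a fun i => lt_of_le_of_ne (hpos i) (hcon i).symm)
  · exfalso
    obtain ⟨c, hc, ⟨i, hi⟩, rfl⟩ := hy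
    -- independence of any pair together with q
    have hind : ∀ j k : Fin 3, j ≠ k → LinearIndependent ℝ ![q, v j, v k] := by
      intro j k hjk
      have h2 : LinearIndependent ℝ ![v j, v k] := by
        have := hv.comp ![j, k] (by
          intro a b hab
          fin_cases a <;> fin_cases b <;> simp_all)
        convert this using 1
        ext a
        fin_cases a <;> rfl
      refine linearIndependent_finCons.2 ?_
      refine ⟨h2, fun hmem => hspan ?_⟩
      have hsub : Submodule.span ℝ (Set.range ![v j, v k]) ≤ Submodule.span ℝ (Set.range v) := by
        apply Submodule.span_mono
        rintro _ ⟨a, rfl⟩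
        fin_cases a
        · exact ⟨j, rfl⟩
        · exact ⟨k, rfl⟩
      exact (Submodule.mem_span_range_iff_exists_fun ℝ).1 (hsub hmem)
    by_cases hj : ∃ j, j ≠ i ∧ 0 < c j
    · obtain ⟨j, hji, hj⟩ := hj
      obtain ⟨z1, z2⟩ := hyq 1 1 zero_le_one zero_le_one (by norm_num)
      rw [one_smul, one_smul] at z1 z2
      have hy' : ∀ k, 0 < c k → ∃ c' : ℝ, 0 < c' ∧ v k ∈ closure T.P ∧
          (∑ i, c i • v i + q) - c' • v k ∈ closure T.P := by
        intro k hk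
        refine ⟨c k, hk, vK k, ?_⟩
        rw [← Finset.add_sum_erase _ _ (Finset.mem_univ k)]
        have := T.K_add hqK (sumK (Finset.univ.erase k) c fun k _ => hc k)
        convert this using 1
        abel
      refine T.D _ z1 z2 _ (hind i j hji.symm) fun k => ?_
      fin_cases k
      · exact ⟨1, one_pos, hqK, by simpa using sumK _ c fun k _ => hc k⟩
      · exact hy' i hi
      · exact hy' j hj
    · push Not at hj
      have hz : ∀ j, j ≠ i → c j = 0 := fun j h => le_antisymm (hj j h) (hc j)
      have hsum : ∑ j, c j • v j = c i • v i := by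
        apply Finset.sum_eq_single i
        · intro j _ h; rw [hz j h, zero_smul]
        · simp
      rw [hsum] at hyq
      obtain ⟨j, k, hji, hki, hjk⟩ : ∃ j k : Fin 3, j ≠ i ∧ k ≠ i ∧ j ≠ k := by
        fin_cases i
        · exact ⟨1, 2, by decide, by decide, by decide⟩
        · exact ⟨0, 2, by decide, by decide, by decide⟩
        · exact ⟨0, 1, by decide, by decide, by decide⟩
      have huniv : (Finset.univ : Finset (Fin 3)) = {i, j, k} := by
        have : ∀ i j k : Fin 3, j ≠ i → k ≠ i → j ≠ k →
            (Finset.univ : Finset (Fin 3)) = {i, j, k} := by decide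
        exact this i j k hji hki hjk
      have hS : ∀ a b e : ℝ, ∃ c : Fin 3 → ℝ, c i = a ∧ c j = b ∧ c k = e ∧
          ∑ l, c l • v l = a • v i + b • v j + e • v k := by
        intro a b e
        refine ⟨fun l => if l = i then a else if l = j then b else e, by simp, by simp [hji],
          by simp [hki, hjk.symm], ?_⟩
        rw [huniv, Finset.sum_insert (by simp [hji.symm, hki.symm]),
          Finset.sum_insert (by simp [hjk]), Finset.sum_singleton]
        simp [hji, hki, hjk.symm, add_assoc]
      have hall : ∀ p : Fin 3 → Prop, p i → p j → p k → ∀ l, p l := by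
        intro p h1 h2 h3 l
        have : l ∈ ({i, j, k} : Finset (Fin 3)) := huniv ▸ Finset.mem_univ l
        simp only [Finset.mem_insert, Finset.mem_singleton] at this
        rcases this with rfl | rfl | rfl <;> assumption
      have hZ' : ∀ a b e : ℝ, 0 ≤ a → 0 ≤ b → 0 ≤ e → 0 < a + b + e →
          a • v i + b • v j + e • v k ∈ T.Z := by
        intro a b e h1 h2 h3 h4
        obtain ⟨c, r1, r2, r3, r4⟩ := hS a b e
        rw [← r4]
        refine hZ c (hall _ (by simpa [r1]) (by simpa [r2]) (by simpa [r3])) ?_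
        by_contra hcon
        push Not at hcon
        linarith [hcon i, hcon j, hcon k]
      have hB' : ∀ a b e : ℝ, 0 ≤ a → 0 ≤ b → 0 ≤ e → (a = 0 ∨ b = 0 ∨ e = 0) →
          a • v i + b • v j + e • v k ∉ T.P := by
        intro a b e h1 h2 h3 h4
        obtain ⟨c, r1, r2, r3, r4⟩ := hS a b e
        rw [← r4]
        refine hB c (hall _ (by simpa [r1]) (by simpa [r2]) (by simpa [r3])) ?_
        rcases h4 with h | h | h
        · exact ⟨i, by rw [r1, h]⟩
        · exact ⟨j, by rw [r2, h]⟩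
        · exact ⟨k, by rw [r3, h]⟩
      have nq : ∀ s : ℝ, 0 ≤ s → v i + s • q ∉ T.P := by
        intro s hs
        have := (hyq (c i)⁻¹ s (inv_nonneg.2 hi.le) hs (by positivity)).2
        rwa [smul_smul, inv_mul_cancel₀ hi.ne', one_smul] at this
      have viZ : v i ∈ T.Z := by simpa using hZ' 1 0 0 (by norm_num) le_rfl le_rfl (by norm_num)
      have vjZ : v j ∈ T.Z := by simpa using hZ' 0 1 0 le_rfl (by norm_num) le_rfl (by norm_num)
      have vkZ : v k ∈ T.Z := by simpa using hZ' 0 0 1 le_rfl le_rfl (by norm_num) (by norm_num)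
      have pq : ∀ j, j ≠ i → v j ∈ T.Z → v i + v j + q ∈ T.P := by
        intro j hj hjZ
        by_contra hcon
        refine T.D _ (T.Z_add _ (T.Z_add _ viZ _ hjZ) _ hqZ.1) hcon _ (hind i j hj.symm) fun k => ?_
        fin_cases k
        · exact ⟨1, one_pos, hqK, by simpa using T.K_add (vK i) (vK j)⟩
        · refine ⟨1, one_pos, vK i, ?_⟩
          convert T.K_add (vK j) hqK using 1
          simp; abel
        · refine ⟨1, one_pos, vK j, ?_⟩
          convert T.K_add (vK i) hqK using 1
          simp; abel
      have hPP : v i + v j + v k ∈ T.P := by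
        obtain ⟨c, r1, r2, r3, r4⟩ := hS 1 1 1
        have := hP c (hall _ (by simp [r1]) (by simp [r2]) (by simp [r3]))
        rw [r4] at this
        simpa using this
      refine T.zoom_false (vK i) (vK j) (vK k) hqK ?_ ?_ ?_ hPP (pq j hji vjZ) (pq k hki vkZ)
        ?_ ?_ nq
      · exact T.Z_add _ vjZ _ vkZ
      · simpa using hB' 0 1 1 le_rfl zero_le_one zero_le_one (by simp)
      · intro t ht
        obtain ⟨c, r1, r2, r3, r4⟩ := hS 1 t t
        have := hCc c (hall _ (by simp [r1]) (by simpa [r2]) (by simpa [r3]))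
        rw [r4] at this
        convert this using 1
        module
      · intro s hs
        simpa using hB' 1 s 0 zero_le_one hs le_rfl (by simp)
      · intro s hs
        simpa using hB' 1 0 s zero_le_one le_rfl hs (by simp)

end Ab

/-! ### projective topology -/

/-- nonzero vectors representing points of `A`. -/
def lft (A : Set (PSpace d)) : Set (Fin d → ℝ) :=
  {v | ∃ h : v ≠ 0, Projectivization.mk ℝ v h ∈ A}

lemma mk_smul_eq {v : Fin d → ℝ} (hv : v ≠ 0) {c : ℝ} (hc : c ≠ 0) (h : c • v ≠ 0) :
    Projectivization.mk ℝ (c • v) h = Projectivization.mk ℝ v hv := by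
  rw [Projectivization.mk_eq_mk_iff']
  exact ⟨c, rfl⟩

lemma lft_smul {A : Set (PSpace d)} {v : Fin d → ℝ} {c : ℝ} (hc : c ≠ 0) (hv : v ∈ lft A) :
    c • v ∈ lft A := by
  obtain ⟨h, hA⟩ := hv
  refine ⟨smul_ne_zero hc h, ?_⟩
  rwa [mk_smul_eq h hc]

lemma lft_smul_iff {A : Set (PSpace d)} {v : Fin d → ℝ} {c : ℝ} (hc : c ≠ 0) :
    c • v ∈ lft A ↔ v ∈ lft A := by
  refine ⟨fun h => ?_, lft_smul hc⟩
  have := lft_smul (inv_ne_zero hc) h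
  rwa [smul_smul, inv_mul_cancel₀ hc, one_smul] at this

lemma lft_mono {A B : Set (PSpace d)} (h : A ⊆ B) : lft A ⊆ lft B :=
  fun _ ⟨h1, h2⟩ => ⟨h1, h h2⟩

lemma mem_lft_iff {A : Set (PSpace d)} {v : Fin d → ℝ} (hv : v ≠ 0) :
    v ∈ lft A ↔ Projectivization.mk ℝ v hv ∈ A := ⟨fun ⟨_, h⟩ => h, fun h => ⟨hv, h⟩⟩

lemma rep_mem_lft {A : Set (PSpace d)} {x : PSpace d} : x.rep ∈ lft A ↔ x ∈ A := by
  rw [mem_lft_iff x.rep_nonzero, x.mk_rep]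

lemma mk_continuous : Continuous (fun w : {v : Fin d → ℝ // v ≠ 0} =>
    (Projectivization.mk ℝ w.1 w.2 : PSpace d)) :=
  continuous_quotient_mk' (s := projectivizationSetoid ℝ (Fin d → ℝ))

lemma isOpen_iff_lft {A : Set (PSpace d)} : IsOpen A ↔ IsOpen (lft A) := by
  have h1 : IsOpen A ↔ IsOpen ((fun w : {v : Fin d → ℝ // v ≠ 0} =>
    (Projectivization.mk ℝ w.1 w.2 : PSpace d)) ⁻¹' A) :=
    (isOpen_coinduced (f := (Quotient.mk (projectivizationSetoid ℝ (Fin d → ℝ))))).trans Iff.rfl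
  have ho : IsOpen {v : Fin d → ℝ | v ≠ 0} := isOpen_ne
  rw [h1, ho.isOpenEmbedding_subtypeVal.isOpen_iff_image_isOpen]
  have : (Subtype.val '' ((fun w : {v : Fin d → ℝ // v ≠ 0} =>
    (Projectivization.mk ℝ w.1 w.2 : PSpace d)) ⁻¹' A)) = lft A := by
    ext v
    constructor
    · rintro ⟨⟨w, hw⟩, h, rfl⟩; exact ⟨hw, h⟩
    · rintro ⟨hw, h⟩; exact ⟨⟨v, hw⟩, h, rfl⟩
  rw [← this]
  exact Iff.rfl

lemma closure_lft_smul {A : Set (PSpace d)} {v : Fin d → ℝ} {c : ℝ} (hc : c ≠ 0)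
    (hv : v ∈ closure (lft A)) : c • v ∈ closure (lft A) :=
  map_mem_closure (continuous_const_smul c) hv (fun _ h => lft_smul hc h)

lemma lft_closure {A : Set (PSpace d)} {v : Fin d → ℝ} (hv : v ≠ 0) :
    v ∈ lft (closure A) ↔ v ∈ closure (lft A) := by
  rw [mem_lft_iff hv]
  constructor
  · intro h
    by_contra hcon
    let A' : Set (PSpace d) := {x | x.rep ∉ closure (lft A)}
    have key : ∀ w : Fin d → ℝ, ∀ hw : w ≠ 0,
        Projectivization.mk ℝ w hw ∈ A' ↔ w ∉ closure (lft A) := by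
      intro w hw
      obtain ⟨c, hc⟩ := Projectivization.exists_smul_eq_mk_rep ℝ w hw
      have hc0 : (c : ℝ) ≠ 0 := c.ne_zero
      change (Projectivization.mk ℝ w hw).rep ∉ closure (lft A) ↔ _
      rw [← hc, not_iff_not]
      change (c : ℝ) • w ∈ _ ↔ _
      refine ⟨fun h => ?_, closure_lft_smul hc0⟩
      have := closure_lft_smul (inv_ne_zero hc0) h
      rwa [smul_smul, inv_mul_cancel₀ hc0, one_smul] at this
    have hopen : IsOpen A' := by
      rw [isOpen_iff_lft]
      have : lft A' = {w : Fin d → ℝ | w ≠ 0} ∩ (closure (lft A))ᶜ := by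
        ext w
        constructor
        · rintro ⟨h1, h2⟩; exact ⟨h1, (key w h1).1 h2⟩
        · rintro ⟨h1, h2⟩; exact ⟨h1, (key w h1).2 h2⟩
      rw [this]
      exact isOpen_ne.inter isClosed_closure.isOpen_compl
    obtain ⟨x, hx1, hx2⟩ := mem_closure_iff.1 h A' hopen ((key v hv).2 hcon)
    exact hx1 (subset_closure (rep_mem_lft.2 hx2))
  · intro h
    rw [mem_closure_iff]
    intro O hO hvO
    obtain ⟨w, ⟨hw, h1⟩, ⟨_, h2⟩⟩ := mem_closure_iff.1 h (lft O) (isOpen_iff_lft.1 hO) ⟨hv, hvO⟩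
    exact ⟨_, h1, h2⟩

/-! ### charts -/

lemma f_rep_ne {f : (Fin d → ℝ) →ₗ[ℝ] ℝ} {v : Fin d → ℝ} (hv : v ≠ 0) :
    f (Projectivization.mk ℝ v hv).rep ≠ 0 ↔ f v ≠ 0 := by
  obtain ⟨c, hc⟩ := Projectivization.exists_smul_eq_mk_rep ℝ v hv
  have hc0 : (c : ℝ) ≠ 0 := c.ne_zero
  rw [← hc]
  change f ((c : ℝ) • v) ≠ 0 ↔ _
  simp [hc0]

lemma chartMap_mk {f : (Fin d → ℝ) →ₗ[ℝ] ℝ} {v : Fin d → ℝ} (hv : v ≠ 0) :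
    chartMap f (Projectivization.mk ℝ v hv) = (f v)⁻¹ • v := by
  obtain ⟨c, hc⟩ := Projectivization.exists_smul_eq_mk_rep ℝ v hv
  have hc0 : (c : ℝ) ≠ 0 := c.ne_zero
  unfold chartMap
  rw [← hc]
  change (f ((c : ℝ) • v))⁻¹ • ((c : ℝ) • v) = _
  rw [map_smul, smul_eq_mul, smul_smul, mul_inv, mul_assoc, mul_comm, mul_assoc,
    mul_inv_cancel₀ hc0, mul_one]

lemma f_chartMap {f : (Fin d → ℝ) →ₗ[ℝ] ℝ} {x : PSpace d} (hx : f x.rep ≠ 0) :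
    f (chartMap f x) = 1 := by
  unfold chartMap
  rw [map_smul, smul_eq_mul, inv_mul_cancel₀ hx]

lemma chartMap_ne {f : (Fin d → ℝ) →ₗ[ℝ] ℝ} {x : PSpace d} (hx : f x.rep ≠ 0) :
    chartMap f x ≠ 0 := by
  intro h
  have := f_chartMap hx
  rw [h, map_zero] at this
  exact zero_ne_one this

lemma mk_chartMap {f : (Fin d → ℝ) →ₗ[ℝ] ℝ} {x : PSpace d} (hx : f x.rep ≠ 0) :
    Projectivization.mk ℝ (chartMap f x) (chartMap_ne hx) = x := by
  conv_rhs => rw [← x.mk_rep]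
  exact mk_smul_eq x.rep_nonzero (inv_ne_zero hx) _

lemma chartMap_mem_lft {f : (Fin d → ℝ) →ₗ[ℝ] ℝ} {A : Set (PSpace d)} {x : PSpace d}
    (hx : f x.rep ≠ 0) : chartMap f x ∈ lft A ↔ x ∈ A := by
  rw [mem_lft_iff (chartMap_ne hx), mk_chartMap hx]

lemma ne_of_f {f : (Fin d → ℝ) →ₗ[ℝ] ℝ} {v : Fin d → ℝ} (h : f v ≠ 0) : v ≠ 0 := by
  rintro rfl; exact h (map_zero f)

lemma mem_image_chart {f : (Fin d → ℝ) →ₗ[ℝ] ℝ} {A : Set (PSpace d)}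
    (hA : ∀ x ∈ A, f x.rep ≠ 0) {v : Fin d → ℝ} (hv : f v ≠ 0) :
    (f v)⁻¹ • v ∈ chartMap f '' A ↔ v ∈ lft A := by
  constructor
  · rintro ⟨x, hx, h⟩
    rw [← lft_smul_iff (inv_ne_zero hv), ← h]
    exact (chartMap_mem_lft (hA x hx)).2 hx
  · rintro ⟨h, hx⟩
    exact ⟨_, hx, chartMap_mk h⟩

lemma chartMap_continuousOn (f : (Fin d → ℝ) →ₗ[ℝ] ℝ) :
    ContinuousOn (chartMap f) {x | f x.rep ≠ 0} := by
  have hfc : Continuous f := f.continuous_of_finiteDimensional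
  have hne : IsOpen {v : Fin d → ℝ | f v ≠ 0} := isOpen_ne.preimage hfc
  have hs : IsOpen {x : PSpace d | f x.rep ≠ 0} := by
    rw [isOpen_iff_lft]
    convert hne using 1
    ext v
    constructor
    · rintro ⟨h, hx⟩; exact (f_rep_ne h).1 hx
    · intro h; exact ⟨ne_of_f h, (f_rep_ne (ne_of_f h)).2 h⟩
  rw [continuousOn_open_iff hs]
  intro U hU
  rw [isOpen_iff_lft]
  have hc : ContinuousOn (fun v : Fin d → ℝ => (f v)⁻¹ • v) {v | f v ≠ 0} :=
    (hfc.continuousOn.inv₀ fun _ h => h).smul continuousOn_id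
  convert (continuousOn_open_iff hne).1 hc U hU using 1
  ext v
  constructor
  · rintro ⟨h, hx, hx2⟩
    rw [mem_preimage, chartMap_mk h] at hx2
    exact ⟨(f_rep_ne h).1 hx, hx2⟩
  · rintro ⟨h, hx2⟩
    refine ⟨ne_of_f h, (f_rep_ne (ne_of_f h)).2 h, ?_⟩
    rwa [mem_preimage, chartMap_mk]

lemma sign_lemma {f : (Fin d → ℝ) →ₗ[ℝ] ℝ} {A : Set (Fin d → ℝ)} (hA : Convex ℝ A)
    (hne : ∀ a ∈ A, f a ≠ 0) {a : Fin d → ℝ} (ha : a ∈ A) (hfa : 0 < f a) {b : Fin d → ℝ}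
    (hb : b ∈ A) : 0 < f b := by
  by_contra hcon
  have hlt : f b < 0 := lt_of_le_of_ne (not_lt.1 hcon) (hne b hb)
  have hs : 0 < f a - f b := by linarith
  refine hne _ (hA ha hb (a := -f b / (f a - f b)) (b := f a / (f a - f b))
    (div_nonneg (by linarith) hs.le) (div_nonneg hfa.le hs.le) ?_) ?_
  · rw [← add_div, div_eq_one_iff_eq hs.ne']; ring
  · simp only [map_add, map_smul, smul_eq_mul]; field_simp; ring

lemma pact_mk (g : (Fin d → ℝ) ≃ₗ[ℝ] (Fin d → ℝ)) {v : Fin d → ℝ} (hv : v ≠ 0) (h : g v ≠ 0) :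
    pact g (Projectivization.mk ℝ v hv) = Projectivization.mk ℝ (g v) h := rfl

lemma lft_image_pact {g : (Fin d → ℝ) ≃ₗ[ℝ] (Fin d → ℝ)} {A : Set (PSpace d)} {v : Fin d → ℝ} :
    g v ∈ lft (pact g '' A) ↔ v ∈ lft A := by
  have inj : Function.Injective (pact g) := Projectivization.map_injective _ _
  constructor
  · rintro ⟨h, x, hx, hxe⟩
    have hv : v ≠ 0 := by rintro rfl; exact h (map_zero g)
    refine ⟨hv, ?_⟩
    rw [← pact_mk g hv] at hxe
    rwa [← inj hxe]
  · rintro ⟨h, hx⟩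
    have hv : g v ≠ 0 := by simpa using h
    exact ⟨hv, _, hx, pact_mk g h hv⟩


namespace CCSetup

variable (T : CCSetup d)

abbrev f : (Fin d → ℝ) →ₗ[ℝ] ℝ := chartOf T.Ω

lemma chart_spec : (∀ x ∈ closure T.Ω, T.f x.rep ≠ 0) ∧
    Convex ℝ (chartMap T.f '' T.Ω) ∧ Bornology.IsBounded (chartMap T.f '' T.Ω) := by
  have h := T.properlyConvex_Ω
  have : T.f = h.choose := by simp only [f, chartOf, dif_pos h]
  rw [this]
  exact h.choose_spec

lemma f_ne {x : PSpace d} (hx : x ∈ closure T.Ω) : T.f x.rep ≠ 0 := T.chart_spec.1 x hx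

lemma f_ne' {v : Fin d → ℝ} (hv : v ∈ lft (closure T.Ω)) : T.f v ≠ 0 := by
  obtain ⟨h, hv⟩ := hv
  exact (f_rep_ne h).1 (T.f_ne hv)

lemma fcont : Continuous T.f := T.f.continuous_of_finiteDimensional

def P : Set (Fin d → ℝ) := {v | 0 < T.f v ∧ v ∈ lft T.Ω}

abbrev K : Set (Fin d → ℝ) := closure T.P

lemma P_iff {v : Fin d → ℝ} (hv : 0 < T.f v) : v ∈ T.P ↔ (T.f v)⁻¹ • v ∈ chartMap T.f '' T.Ω := by
  rw [mem_image_chart (fun x hx => T.f_ne (subset_closure hx)) hv.ne']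
  exact ⟨fun h => h.2, fun h => ⟨hv, h⟩⟩

lemma P_open : IsOpen T.P :=
  (isOpen_lt continuous_const T.fcont).inter (isOpen_iff_lft.1 T.isOpen_Ω)

lemma P_smul (c : ℝ) (hc : 0 < c) (x) (hx : x ∈ T.P) : c • x ∈ T.P :=
  ⟨by rw [map_smul]; exact mul_pos hc hx.1, lft_smul hc.ne' hx.2⟩

lemma norm_add {f : (Fin d → ℝ) →ₗ[ℝ] ℝ} {A : Set (Fin d → ℝ)} (hA : Convex ℝ A)
    {x y : Fin d → ℝ} (hx : 0 < f x) (hy : 0 < f y) (hxA : (f x)⁻¹ • x ∈ A)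
    (hyA : (f y)⁻¹ • y ∈ A) : (f (x + y))⁻¹ • (x + y) ∈ A := by
  have hs : 0 < f x + f y := by positivity
  have := hA hxA hyA (a := f x / (f x + f y)) (b := f y / (f x + f y)) (by positivity)
    (by positivity) (by rw [← add_div, div_self hs.ne'])
  convert this using 1
  rw [map_add, smul_smul, smul_smul, smul_add]
  congr 2 <;> field_simp

lemma P_add (x) (hx : x ∈ T.P) (y) (hy : y ∈ T.P) : x + y ∈ T.P := by
  have hs : 0 < T.f (x + y) := by rw [map_add]; exact add_pos hx.1 hy.1
  rw [T.P_iff hs]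
  exact norm_add T.chart_spec.2.1 hx.1 hy.1 ((T.P_iff hx.1).1 hx) ((T.P_iff hy.1).1 hy)

lemma P_conv : Convex ℝ T.P := by
  rw [convex_iff_forall_pos]
  intro x hx y hy a b ha hb _
  exact T.P_add _ (T.P_smul a ha x hx) _ (T.P_smul b hb y hy)

def R : ℝ := (isBounded_iff_forall_norm_le.1 T.chart_spec.2.2).choose

lemma P_bd (x) (hx : x ∈ T.P) : ‖x‖ ≤ T.R * T.f x := by
  have := (isBounded_iff_forall_norm_le.1 T.chart_spec.2.2).choose_spec _ ((T.P_iff hx.1).1 hx)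
  change _ ≤ T.R at this
  rw [norm_smul, norm_inv, Real.norm_of_nonneg hx.1.le, inv_mul_le_iff₀ hx.1] at this
  linarith

lemma P_ne : T.P.Nonempty := by
  obtain ⟨x, hx⟩ := T.nonempty_Ω
  have := T.f_ne (subset_closure hx)
  exact ⟨chartMap T.f x, by rw [f_chartMap this]; exact one_pos, (chartMap_mem_lft this).2 hx⟩

lemma K_bd {x : Fin d → ℝ} (hx : x ∈ T.K) : ‖x‖ ≤ T.R * T.f x := by
  have hcl : IsClosed {x : Fin d → ℝ | ‖x‖ ≤ T.R * T.f x} :=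
    isClosed_le continuous_norm (continuous_const.mul T.fcont)
  exact closure_minimal T.P_bd hcl hx

lemma K_nonneg {x : Fin d → ℝ} (hx : x ∈ T.K) : 0 ≤ T.f x := by
  have hcl : IsClosed {x : Fin d → ℝ | 0 ≤ T.f x} := isClosed_le continuous_const T.fcont
  exact closure_minimal (fun x hx => hx.1.le) hcl hx

lemma K_pos {x : Fin d → ℝ} (hx : x ∈ T.K) (h0 : x ≠ 0) : 0 < T.f x := by
  refine lt_of_le_of_ne (T.K_nonneg hx) fun h => h0 ?_
  have := T.K_bd hx
  rw [← h, mul_zero] at this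
  exact norm_le_zero_iff.1 this

lemma K_lft {x : Fin d → ℝ} (hx : x ∈ T.K) (h0 : x ≠ 0) : x ∈ lft (closure T.Ω) :=
  (lft_closure h0).2 (closure_mono (fun _ h => h.2) hx)

lemma mem_closure_pos {A : Set (Fin d → ℝ)} {x : Fin d → ℝ} (hx : x ∈ closure A)
    (h : 0 < T.f x) : x ∈ closure {v | 0 < T.f v ∧ v ∈ A} := by
  rw [mem_closure_iff] at hx ⊢
  intro o ho hxo
  obtain ⟨w, hw1, hw2⟩ := hx (o ∩ {v | 0 < T.f v}) (ho.inter (isOpen_lt continuous_const T.fcont))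
    ⟨hxo, h⟩
  exact ⟨w, hw1.1, hw1.2, hw2⟩

lemma lft_K {x : Fin d → ℝ} (hx : x ∈ lft (closure T.Ω)) (h : 0 < T.f x) : x ∈ T.K :=
  T.mem_closure_pos ((lft_closure hx.1).1 hx) h

lemma cmap_K {x : PSpace d} (hx : x ∈ closure T.Ω) : cmap T.Ω x ∈ T.K ∧ T.f (cmap T.Ω x) = 1 := by
  have h1 : T.f (cmap T.Ω x) = 1 := f_chartMap (T.f_ne hx)
  exact ⟨T.lft_K ((chartMap_mem_lft (T.f_ne hx)).2 hx) (by rw [h1]; exact one_pos), h1⟩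

lemma K_add {x y : Fin d → ℝ} (hx : x ∈ T.K) (hy : y ∈ T.K) : x + y ∈ T.K :=
  map_mem_closure₂ (by fun_prop : Continuous fun p : (Fin d → ℝ) × (Fin d → ℝ) => p.1 + p.2)
    hx hy T.P_add

lemma K_zero : (0 : Fin d → ℝ) ∈ T.K := by
  obtain ⟨p, hp⟩ := T.P_ne
  have : Tendsto (fun n : ℕ => (1 / ((n : ℝ) + 1)) • p) atTop (nhds ((0 : ℝ) • p)) :=
    tendsto_one_div_add_atTop_nhds_zero_nat.smul_const p
  rw [zero_smul] at this
  exact mem_closure_of_tendsto this (Eventually.of_forall fun n => T.P_smul _ (by positivity) _ hp)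

lemma K_smul {c : ℝ} (hc : 0 ≤ c) {x : Fin d → ℝ} (hx : x ∈ T.K) : c • x ∈ T.K := by
  rcases hc.eq_or_lt with h | h
  · rw [← h, zero_smul]; exact T.K_zero
  · exact map_mem_closure (continuous_const_smul c) hx (T.P_smul c h)

/-! invariance -/

lemma Ω_inv {g} (hg : g ∈ T.Λ) {v : Fin d → ℝ} (hv : v ∈ lft T.Ω) : g v ∈ lft T.Ω := by
  have := lft_image_pact (g := g).2 hv
  rwa [T.inv_Ω g hg] at this

/-- A scalar multiple of a group element mapping one vector of `P` to `P` preserves `P`. -/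
lemma P_inv {g} (hg : g ∈ T.Λ) {c : ℝ} (hc : c ≠ 0) {x : Fin d → ℝ} (hx : x ∈ T.P)
    (hgx : 0 < T.f (c • g x)) {v : Fin d → ℝ} (hv : v ∈ T.P) : c • g v ∈ T.P := by
  have key : ∀ u ∈ T.P, c • g u ∈ lft T.Ω := fun u hu => lft_smul hc (T.Ω_inv hg hu.2)
  refine ⟨?_, key v hv⟩
  have := sign_lemma (f := T.f ∘ₗ (c • g.toLinearMap)) T.P_conv
    (fun a ha => T.f_ne' (lft_mono subset_closure (key a ha))) hx hgx hv
  exact this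

lemma limitSet_sub : limitSet T.Ω T.Λ ⊆ closure T.Ω := by
  intro x hx
  simp only [limitSet, mem_iUnion] at hx
  obtain ⟨p, hp, hx, -⟩ := hx
  refine closure_mono ?_ hx
  rintro _ ⟨g, hg, rfl⟩
  rw [← T.inv_Ω g hg]
  exact ⟨p, hp, rfl⟩

lemma orbit_inv {g} (hg : g ∈ T.Λ) {p : PSpace d} {v : Fin d → ℝ} (hv : v ∈ lft (porbit T.Λ p)) :
    g v ∈ lft (porbit T.Λ p) := by
  have := lft_image_pact (g := g).2 hv
  refine lft_mono ?_ this
  rintro _ ⟨_, ⟨h, hh, rfl⟩, rfl⟩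
  refine ⟨g * h, T.Λ.mul_mem hg hh, ?_⟩
  induction p using Projectivization.ind with
  | h w hw => rfl

lemma inv_apply' (g : (Fin d → ℝ) ≃ₗ[ℝ] (Fin d → ℝ)) (v) : g⁻¹ (g v) = v := g.symm_apply_apply v
lemma apply_inv' (g : (Fin d → ℝ) ≃ₗ[ℝ] (Fin d → ℝ)) (v) : g (g⁻¹ v) = v := g.apply_symm_apply v

lemma cont_g (g : (Fin d → ℝ) ≃ₗ[ℝ] (Fin d → ℝ)) : Continuous g :=
  g.toLinearMap.continuous_of_finiteDimensional

lemma limitSet_inv {g} (hg : g ∈ T.Λ) {v : Fin d → ℝ} (hv : v ∈ lft (limitSet T.Ω T.Λ)) :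
    g v ∈ lft (limitSet T.Ω T.Λ) := by
  obtain ⟨h0, hv⟩ := hv
  have hg0 : g v ≠ 0 := by simpa using h0
  simp only [limitSet, mem_iUnion] at hv
  obtain ⟨p, hp, hv1, hv2⟩ := hv
  refine ⟨hg0, ?_⟩
  simp only [limitSet, mem_iUnion]
  refine ⟨p, hp, ?_, fun hcon => hv2 ?_⟩
  · rw [← mem_lft_iff, lft_closure hg0]
    exact map_mem_closure (cont_g g) ((lft_closure h0).1 ⟨h0, hv1⟩) (fun _ h => T.orbit_inv hg h)
  · have := T.orbit_inv (T.Λ.inv_mem hg) ⟨hg0, hcon⟩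
    rw [inv_apply'] at this
    exact this.2

abbrev C : Set (PSpace d) := coreC T.Ω T.Λ

abbrev H : Set (Fin d → ℝ) := convexHull ℝ (cmap T.Ω '' limitSet T.Ω T.Λ)

lemma C_sub : T.C ⊆ T.Ω := fun _ h => h.1

lemma lft_C {v : Fin d → ℝ} : v ∈ lft T.C ↔ v ∈ lft T.Ω ∧ (T.f v)⁻¹ • v ∈ T.H := by
  constructor
  · rintro ⟨h, h1, h2⟩
    rw [cmap, chartMap_mk] at h2
    exact ⟨⟨h, h1⟩, h2⟩
  · rintro ⟨⟨h, h1⟩, h2⟩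
    refine ⟨h, h1, ?_⟩
    rwa [cmap, chartMap_mk]

lemma C_inv {g} (hg : g ∈ T.Λ) {v : Fin d → ℝ} (hv : v ∈ lft T.C) : g v ∈ lft T.C := by
  have hvΩ := lft_mono T.C_sub hv
  have hfv := T.f_ne' (lft_mono subset_closure hvΩ)
  -- normalise
  set x := (T.f v)⁻¹ • v with hx
  have hxC : x ∈ lft T.C := lft_smul (inv_ne_zero hfv) hv
  have hfx : T.f x = 1 := by rw [hx, map_smul, smul_eq_mul, inv_mul_cancel₀ hfv]
  have hxP : x ∈ T.P := ⟨by rw [hfx]; exact one_pos, lft_mono T.C_sub hxC⟩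
  have hxH : x ∈ T.H := by have := (T.lft_C.1 hxC).2; rwa [hfx, inv_one, one_smul] at this
  suffices h : g x ∈ lft T.C by
    rwa [hx, map_smul, lft_smul_iff (inv_ne_zero hfv)] at h
  have hgΩ := T.Ω_inv hg hxP.2
  have hc : T.f (g x) ≠ 0 := T.f_ne' (lft_mono subset_closure hgΩ)
  set c := (T.f (g x))⁻¹ with hcdef
  have hc0 : c ≠ 0 := inv_ne_zero hc
  have hone : T.f (c • g x) = 1 := by rw [map_smul, smul_eq_mul, inv_mul_cancel₀ hc]
  have hPP : ∀ u ∈ T.P, c • g u ∈ T.P := fun u hu =>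
    T.P_inv hg hc0 hxP (by rw [hone]; exact one_pos) hu
  have hKK : ∀ u ∈ T.K, c • g u ∈ T.K := fun u hu =>
    map_mem_closure (f := fun u => c • g u) ((cont_g g).const_smul c) hu hPP
  let CH : Set (Fin d → ℝ) := {u | 0 < T.f (c • g u) ∧ (T.f (c • g u))⁻¹ • (c • g u) ∈ T.H}
  have hCH : Convex ℝ CH := by
    rw [convex_iff_forall_pos]
    intro u hu w hw a b ha hb _
    have sc : ∀ (u : Fin d → ℝ) (a : ℝ), 0 < a → u ∈ CH → 0 < T.f (a • (c • g u)) ∧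
        (T.f (a • (c • g u)))⁻¹ • (a • (c • g u)) ∈ T.H := by
      intro u a ha hu
      refine ⟨by rw [map_smul]; exact mul_pos ha hu.1, ?_⟩
      convert hu.2 using 1
      rw [map_smul T.f a, smul_eq_mul, smul_smul, mul_inv, mul_comm a⁻¹, mul_assoc,
        inv_mul_cancel₀ ha.ne', mul_one]
    have e : c • g (a • u + b • w) = a • (c • g u) + b • (c • g w) := by
      rw [map_add, map_smul, map_smul]; module
    obtain ⟨p1, p2⟩ := sc u a ha hu
    obtain ⟨q1, q2⟩ := sc w b hb hw
    refine ⟨?_, ?_⟩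
    · rw [e, map_add]; exact add_pos p1 q1
    · rw [e]; exact norm_add (convex_convexHull ℝ _) p1 q1 p2 q2
  have hsub : cmap T.Ω '' limitSet T.Ω T.Λ ⊆ CH := by
    rintro _ ⟨p, hp, rfl⟩
    have hpc := T.limitSet_sub hp
    have hK := T.cmap_K hpc
    have hn := T.f_ne hpc
    have hne : cmap T.Ω p ≠ 0 := chartMap_ne hn
    have hgl : c • g (cmap T.Ω p) ∈ lft (limitSet T.Ω T.Λ) :=
      lft_smul hc0 (T.limitSet_inv hg ((chartMap_mem_lft hn).2 hp))
    have hpos := T.K_pos (hKK _ hK.1) hgl.1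
    refine ⟨hpos, subset_convexHull ℝ _ ?_⟩
    exact (mem_image_chart (fun x hx => T.f_ne (T.limitSet_sub hx)) hpos.ne').2 hgl
  have := (convexHull_min hsub hCH hxH).2
  rw [hone, inv_one, one_smul] at this
  rw [T.lft_C]
  exact ⟨hgΩ, this⟩

/-! closedness of `C` in `Ω` -/
lemma C_closed {v : Fin d → ℝ} (hv : v ∈ T.P) (hc : v ∈ closure (lft T.C)) : v ∈ lft T.C := by
  obtain ⟨K, hKC, hK, hcov⟩ := T.cocompact
  have hKf : ∀ x ∈ K, T.f x.rep ≠ 0 := fun x hx => T.f_ne (subset_closure (T.C_sub (hKC hx)))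
  have hκ : IsCompact (chartMap T.f '' K) := hK.image_of_continuousOn
    ((chartMap_continuousOn T.f).mono hKf)
  obtain ⟨r, hr, hball⟩ := Metric.isOpen_iff.1 T.P_open v hv
  have hr2 : Metric.closedBall v (r / 2) ⊆ T.P :=
    (Metric.closedBall_subset_ball (by linarith)).trans hball
  let N : Set (PSpace d) := (fun w : {v : Fin d → ℝ // v ≠ 0} =>
    (Projectivization.mk ℝ w.1 w.2 : PSpace d)) '' (Subtype.val ⁻¹' Metric.closedBall v (r / 2))
  have hN : IsCompact N := by
    refine IsCompact.image ?_ mk_continuous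
    rw [Subtype.isCompact_iff]
    have e : (Subtype.val '' (Subtype.val ⁻¹' Metric.closedBall v (r / 2) :
        Set {v : Fin d → ℝ // v ≠ 0})) = Metric.closedBall v (r / 2) := by
      ext w
      constructor
      · rintro ⟨u, hu, rfl⟩; exact hu
      · intro hw; exact ⟨⟨w, (hr2 hw).2.1⟩, hw, rfl⟩
    have hcb := isCompact_closedBall v (r / 2)
    rw [← e] at hcb
    exact hcb
  have hNΩ : N ⊆ T.Ω := by
    rintro _ ⟨⟨w, hw⟩, h, rfl⟩
    exact (hr2 h).2.2
  have hfin := T.discrete_Λ (K ∪ N) (union_subset (hKC.trans T.C_sub) hNΩ) (hK.union hN)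
  set G := {g : (Fin d → ℝ) ≃ₗ[ℝ] (Fin d → ℝ) | g ∈ T.Λ ∧
    (pact g '' (K ∪ N) ∩ (K ∪ N)).Nonempty}
  have h1 : v ∈ closure (⋃ g ∈ G, lft (pact g '' K)) := by
    rw [mem_closure_iff] at hc ⊢
    intro o ho hvo
    obtain ⟨w, ⟨hw1, hw2⟩, hw3⟩ := hc (o ∩ Metric.ball v (r / 2)) (ho.inter Metric.isOpen_ball)
      ⟨hvo, Metric.mem_ball_self (by linarith)⟩
    obtain ⟨hw0, hwC⟩ := hw3
    have := hcov hwC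
    simp only [mem_iUnion] at this
    obtain ⟨g, hg, k, hk, hgk⟩ := this
    refine ⟨w, hw1, ?_⟩
    simp only [mem_iUnion]
    refine ⟨g, ⟨hg, Projectivization.mk ℝ w hw0, ⟨k, Or.inl hk, hgk⟩, Or.inr ?_⟩, hw0, k, hk, hgk⟩
    exact ⟨⟨w, hw0⟩, Metric.ball_subset_closedBall hw2, rfl⟩
  rw [hfin.closure_biUnion] at h1
  simp only [mem_iUnion] at h1
  obtain ⟨g, hg, h1⟩ := h1
  have h2 : g⁻¹ v ∈ closure (lft K) := by
    refine map_mem_closure (cont_g g⁻¹) h1 fun u hu => ?_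
    rw [← apply_inv' g u] at hu
    exact lft_image_pact.1 hu
  have hΩ : g⁻¹ v ∈ lft T.Ω := T.Ω_inv (T.Λ.inv_mem hg.1) hv.2
  set w := g⁻¹ v
  have hfw : T.f w ≠ 0 := T.f_ne' (lft_mono subset_closure hΩ)
  have h3 : (T.f w)⁻¹ • w ∈ chartMap T.f '' K := by
    rw [← hκ.isClosed.closure_eq]
    have hcont : ContinuousAt (fun u : Fin d → ℝ => (T.f u)⁻¹ • u) w :=
      (T.fcont.continuousAt.inv₀ hfw).smul continuousAt_id
    refine (mem_closure_iff_nhds.2 fun t ht => ?_)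
    have h4 := hcont ht
    have h5 : {u | T.f u ≠ 0} ∈ nhds w := (isOpen_ne.preimage T.fcont).mem_nhds hfw
    obtain ⟨u, hu1, hu2⟩ := mem_closure_iff_nhds.1 h2 _ (inter_mem h4 h5)
    exact ⟨_, hu1.1, (mem_image_chart hKf hu1.2).2 hu2⟩
  have h4 := (mem_image_chart hKf hfw).1 h3
  have := T.C_inv hg.1 (lft_mono hKC h4)
  rwa [apply_inv'] at this

def Cc : Set (Fin d → ℝ) := {v | 0 < T.f v ∧ v ∈ lft T.C}
abbrev Z : Set (Fin d → ℝ) := closure T.Cc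

lemma Cc_sub : T.Cc ⊆ T.P := fun _ h => ⟨h.1, lft_mono T.C_sub h.2⟩

lemma Cc_smul (c : ℝ) (hc : 0 < c) (x) (hx : x ∈ T.Cc) : c • x ∈ T.Cc :=
  ⟨by rw [map_smul]; exact mul_pos hc hx.1, lft_smul hc.ne' hx.2⟩

lemma Cc_add (x) (hx : x ∈ T.Cc) (y) (hy : y ∈ T.Cc) : x + y ∈ T.Cc := by
  have hP := T.P_add x (T.Cc_sub hx) y (T.Cc_sub hy)
  refine ⟨hP.1, T.lft_C.2 ⟨hP.2, ?_⟩⟩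
  exact norm_add (convex_convexHull ℝ _) hx.1 hy.1 (T.lft_C.1 hx.2).2 (T.lft_C.1 hy.2).2

lemma Z_sub : T.Z ⊆ T.K := closure_mono T.Cc_sub

lemma Z_lft {x : Fin d → ℝ} (hx : x ∈ T.Z) (h0 : x ≠ 0) : x ∈ lft (closure T.C) :=
  (lft_closure h0).2 (closure_mono (fun _ h => h.2) hx)

lemma lft_Z {x : Fin d → ℝ} (hx : x ∈ lft (closure T.C)) (h : 0 < T.f x) : x ∈ T.Z :=
  T.mem_closure_pos ((lft_closure hx.1).1 hx) h

/-! faces -/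

lemma openSeg_norm {f : (Fin d → ℝ) →ₗ[ℝ] ℝ} {a b x : Fin d → ℝ} (ha : 0 < f a) (hb : 0 < f b)
    {s t : ℝ} (hs : 0 < s) (ht : 0 < t) (hx : x = s • a + t • b) :
    (f x)⁻¹ • x ∈ openSegment ℝ ((f a)⁻¹ • a) ((f b)⁻¹ • b) := by
  have hfx : f x = s * f a + t * f b := by rw [hx]; simp
  have hpos : 0 < f x := by rw [hfx]; positivity
  refine ⟨s * f a / f x, t * f b / f x, by positivity, by positivity, ?_, ?_⟩
  · rw [← add_div, ← hfx, div_self hpos.ne']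
  · rw [smul_smul, smul_smul]
    conv_rhs => rw [hx, smul_add, smul_smul, smul_smul, ← hx]
    congr 2 <;> field_simp


lemma face_mem {x y : Fin d → ℝ} (hx : 0 < T.f x) (hy : 0 < T.f y) (hxK : x ∈ T.K) (hyK : y ∈ T.K)
    {ε : ℝ} (hε : 0 < ε)
    (h1 : x - ε • y ∈ T.K) (h2 : y - ε • x ∈ T.K) (hx0 : x ≠ 0) (hy0 : y ≠ 0) :
    Projectivization.mk ℝ y hy0 ∈ face T.Ω (Projectivization.mk ℝ x hx0) := by
  have fa := T.K_nonneg h1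
  have fb := T.K_nonneg h2
  simp only [map_sub, map_smul, smul_eq_mul] at fa fb
  have hε1 : ε ≤ 1 := by
    by_contra hcon
    push Not at hcon
    nlinarith
  set a := x - (ε / 2) • y with ha
  set b := y - (ε / 2) • x with hb
  have haK : a ∈ T.K := by
    convert T.K_smul (c := 1 / 2) (by norm_num) (T.K_add h1 hxK) using 1
    rw [ha]; module
  have hbK : b ∈ T.K := by
    convert T.K_smul (c := 1 / 2) (by norm_num) (T.K_add h2 hyK) using 1
    rw [hb]; module
  have hfa : 0 < T.f a := by
    simp only [ha, map_sub, map_smul, smul_eq_mul]; linarith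
  have hfb : 0 < T.f b := by
    simp only [hb, map_sub, map_smul, smul_eq_mul]; linarith
  have ha0 := ne_of_f hfa.ne'
  have hb0 := ne_of_f hfb.ne'
  have hη : 0 < 1 - (ε / 2) * (ε / 2) := by nlinarith
  have hxe : x = (1 - (ε / 2) * (ε / 2))⁻¹ • a + ((1 - (ε / 2) * (ε / 2))⁻¹ * (ε / 2)) • b := by
    rw [mul_smul, ← smul_add, eq_inv_smul_iff₀ hη.ne', ha, hb]; module
  have hye : y = ((1 - (ε / 2) * (ε / 2))⁻¹ * (ε / 2)) • a + (1 - (ε / 2) * (ε / 2))⁻¹ • b := by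
    rw [mul_smul, ← smul_add, eq_inv_smul_iff₀ hη.ne', ha, hb]; module
  refine Or.inr ⟨(T.K_lft hyK hy0).2, _, (T.K_lft haK ha0).2, _, (T.K_lft hbK hb0).2,
    ⟨(T.K_lft hxK hx0).2, ?_⟩, ⟨(T.K_lft hyK hy0).2, ?_⟩⟩
  · rw [cmap, chartMap_mk, chartMap_mk, chartMap_mk]
    exact openSeg_norm hfa hfb (by positivity) (by positivity) hxe
  · rw [cmap, chartMap_mk, chartMap_mk, chartMap_mk]
    exact openSeg_norm hfa hfb (by positivity) (by positivity) hye

lemma face_sub {X : PSpace d} (hX : X ∈ closure T.Ω) : face T.Ω X ⊆ closure T.Ω := by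
  rintro Y (rfl | h)
  · exact hX
  · exact h.1

lemma face_out {X Y : PSpace d} (hX : X ∈ closure T.Ω) (hY : Y ∈ face T.Ω X) :
    ∃ ε : ℝ, 0 < ε ∧ cmap T.Ω X - ε • cmap T.Ω Y ∈ T.K ∧ cmap T.Ω Y - ε • cmap T.Ω X ∈ T.K := by
  rcases hY with rfl | ⟨_, a, ha, b, hb, ⟨_, s, t, hs, ht, hst, hx⟩, ⟨_, s', t', hs', ht', hst', hy⟩⟩
  · exact ⟨1, one_pos, by simpa using T.K_zero, by simpa using T.K_zero⟩
  · have haK := (T.cmap_K ha).1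
    have hbK := (T.cmap_K hb).1
    obtain ⟨ε, hε, h1, h2, h3, h4⟩ : ∃ ε : ℝ, 0 < ε ∧ ε ≤ s ∧ ε ≤ t ∧ ε ≤ s' ∧ ε ≤ t' :=
      ⟨min (min s t) (min s' t'), by positivity, by simp, by simp, by simp, by simp⟩
    refine ⟨ε, hε, ?_, ?_⟩
    · rw [← hx, ← hy]
      convert T.K_add (T.K_smul (c := s - ε * s') (by nlinarith) haK)
        (T.K_smul (c := t - ε * t') (by nlinarith) hbK) using 1
      module
    · rw [← hx, ← hy]
      convert T.K_add (T.K_smul (c := s' - ε * s) (by nlinarith) haK)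
        (T.K_smul (c := t' - ε * t) (by nlinarith) hbK) using 1
      module

lemma face_pc {X : PSpace d} (hX : X ∈ closure T.Ω) : IsProperlyConvex (face T.Ω X) := by
  have hsub := T.face_sub hX
  refine ⟨T.f, fun x hx => T.f_ne (closure_minimal hsub isClosed_closure hx), ?_, ?_⟩
  · obtain ⟨hxK, hx1⟩ := T.cmap_K hX
    rintro _ ⟨Y, hY, rfl⟩ _ ⟨Y', hY', rfl⟩ α β hα hβ hαβ
    obtain ⟨hyK, hy1⟩ := T.cmap_K (hsub hY)
    obtain ⟨hyK', hy1'⟩ := T.cmap_K (hsub hY')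
    obtain ⟨e, he, h1, h2⟩ := T.face_out hX hY
    obtain ⟨e', he', h1', h2'⟩ := T.face_out hX hY'
    change α • cmap T.Ω Y + β • cmap T.Ω Y' ∈ _
    have hXmk : Projectivization.mk ℝ (cmap T.Ω X) (chartMap_ne (T.f_ne hX)) = X :=
      mk_chartMap (T.f_ne hX)
    set x := cmap T.Ω X
    set y := cmap T.Ω Y
    set y' := cmap T.Ω Y'
    obtain ⟨ε, hε, g1, g2⟩ : ∃ ε : ℝ, 0 < ε ∧ ε ≤ e ∧ ε ≤ e' :=
      ⟨min e e', by positivity, by simp, by simp⟩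
    have hz1 : T.f (α • y + β • y') = 1 := by simp [hy1, hy1', hαβ]
    have hz0 : α • y + β • y' ≠ 0 := ne_of_f (f := T.f) (by rw [hz1]; exact one_ne_zero)
    refine ⟨Projectivization.mk ℝ (α • y + β • y') hz0, ?_, ?_⟩
    · rw [← hXmk]
      refine T.face_mem (by rw [hx1]; exact one_pos) (by rw [hz1]; exact one_pos) hxK
        (T.K_add (T.K_smul hα hyK) (T.K_smul hβ hyK')) hε ?_ ?_ _ _
      · have k1 := T.K_add h1 (T.K_smul (sub_nonneg.2 g1) hyK)
        have k2 := T.K_add h1' (T.K_smul (sub_nonneg.2 g2) hyK')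
        convert T.K_add (T.K_smul hα k1) (T.K_smul hβ k2) using 1
        have : β = 1 - α := by linarith
        subst this
        module
      · have k1 := T.K_add h2 (T.K_smul (sub_nonneg.2 g1) hxK)
        have k2 := T.K_add h2' (T.K_smul (sub_nonneg.2 g2) hxK)
        convert T.K_add (T.K_smul hα k1) (T.K_smul hβ k2) using 1
        have : β = 1 - α := by linarith
        subst this
        module
    · rw [chartMap_mk, hz1, inv_one, one_smul]
  · rw [isBounded_iff_forall_norm_le]
    refine ⟨T.R, ?_⟩
    rintro _ ⟨Y, hY, rfl⟩
    obtain ⟨hyK, hy1⟩ := T.cmap_K (hsub hY)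
    have := T.K_bd hyK
    rwa [hy1, mul_one] at this

lemma span_finrank_le (A : Set (Fin d → ℝ)) {p : Fin d → ℝ} (hp : p ∈ A)
    (h : Module.finrank ℝ (affineSpan ℝ A).direction ≤ 1) :
    Module.finrank ℝ (Submodule.span ℝ A) ≤ 2 := by
  have hle : Submodule.span ℝ A ≤ (affineSpan ℝ A).direction ⊔ Submodule.span ℝ {p} := by
    rw [Submodule.span_le]
    intro u hu
    have h1 : u - p ∈ (affineSpan ℝ A).direction :=
      AffineSubspace.vsub_mem_direction (subset_affineSpan ℝ A hu) (subset_affineSpan ℝ A hp)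
    have := Submodule.add_mem_sup h1 (Submodule.mem_span_singleton_self (R := ℝ) p)
    simpa using this
  have h1 := Submodule.finrank_mono hle
  have h2 := Submodule.finrank_add_le_finrank_add_finrank (affineSpan ℝ A).direction
    (Submodule.span ℝ {p})
  have h3 : Module.finrank ℝ (Submodule.span ℝ {p}) ≤ 1 := by
    have := finrank_span_le_card (R := ℝ) ({p} : Set (Fin d → ℝ))
    simpa using this
  omega

lemma D (hdim : ∀ x ∈ closure T.Ω \ T.Ω, (face T.Ω x ∩ closure (coreC T.Ω T.Λ)).Nonempty →
      pdim (face T.Ω x) ≤ 1) (x) (hx : x ∈ T.Z) (hxP : x ∉ T.P) (w : Fin 3 → (Fin d → ℝ))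
    (hw : LinearIndependent ℝ w)
    (h : ∀ i, ∃ c : ℝ, 0 < c ∧ w i ∈ closure T.P ∧ x - c • w i ∈ closure T.P) : False := by
  have hxK : x ∈ T.K := T.Z_sub hx
  have hfx : 0 < T.f x := by
    obtain ⟨c, hc, h1, h2⟩ := h 0
    have h3 := T.K_pos h1 (hw.ne_zero 0)
    have h4 := T.K_nonneg h2
    simp only [map_sub, map_smul, smul_eq_mul] at h4
    nlinarith
  have hx0 := ne_of_f hfx.ne'
  set X : PSpace d := Projectivization.mk ℝ x hx0 with hX
  have hXc : X ∈ closure T.Ω := (T.K_lft hxK hx0).2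
  have hXn : X ∉ T.Ω := fun hn => hxP ⟨hfx, hx0, hn⟩
  have hd := hdim X ⟨hXc, hXn⟩ ⟨X, Or.inl rfl, (T.Z_lft hx hx0).2⟩
  set F := face T.Ω X with hF
  have hFpc : IsProperlyConvex F := T.face_pc hXc
  have hspec : ∀ y ∈ F, chartOf F y.rep ≠ 0 := by
    have e : chartOf F = hFpc.choose := by simp only [chartOf, dif_pos hFpc]
    rw [e]
    exact fun y hy => hFpc.choose_spec.1 y (subset_closure hy)
  have hmem : ∀ (y : Fin d → ℝ) (hy : y ≠ 0), Projectivization.mk ℝ y hy ∈ F →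
      y ∈ Submodule.span ℝ (cmap F '' F) := by
    intro y hy hyF
    have h1 : chartOf F y ≠ 0 := (f_rep_ne hy).1 (hspec _ hyF)
    have h2 : cmap F (Projectivization.mk ℝ y hy) ∈ Submodule.span ℝ (cmap F '' F) :=
      Submodule.subset_span ⟨_, hyF, rfl⟩
    rw [cmap, chartMap_mk] at h2
    have := Submodule.smul_mem _ (chartOf F y) h2
    rwa [smul_smul, mul_inv_cancel₀ h1, one_smul] at this
  have hxF := hmem x hx0 (Or.inl rfl)
  have hwF : ∀ i, w i ∈ Submodule.span ℝ (cmap F '' F) := by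
    intro i
    obtain ⟨c, hc, h1, h2⟩ := h i
    have h3 := T.K_nonneg h1
    have hy : 0 < T.f (x + w i) := by rw [map_add]; linarith
    have hm := T.face_mem hfx hy hxK (T.K_add hxK h1) (ε := c / (1 + c)) (by positivity)
      (by
        convert T.K_smul (c := (1 + c)⁻¹) (by positivity) h2 using 1
        rw [eq_inv_smul_iff₀ (by positivity), smul_sub, smul_smul, mul_div_cancel₀ _ (by positivity)]
        module)
      (by
        convert T.K_add h1 (T.K_smul (c := (1 + c)⁻¹) (by positivity) hxK) using 1
        have : (1 + c)⁻¹ = 1 - c / (1 + c) := by field_simp; ring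
        rw [this]; module)
      hx0 (ne_of_f hy.ne')
    have := Submodule.sub_mem _ (hmem _ _ hm) hxF
    simpa using this
  have h2 := span_finrank_le (cmap F '' F) ⟨X, Or.inl rfl, rfl⟩ hd
  have h3 : Submodule.span ℝ (Set.range w) ≤ Submodule.span ℝ (cmap F '' F) := by
    rw [Submodule.span_le]
    rintro _ ⟨i, rfl⟩
    exact hwF i
  have h4 := Submodule.finrank_mono h3
  rw [finrank_span_eq_card hw, Fintype.card_fin] at h4
  omega

def κ : Set (Fin d → ℝ) := chartMap T.f '' T.cocompact.choose

lemma κ_cpt : IsCompact T.κ := by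
  obtain ⟨h1, h2, -⟩ := T.cocompact.choose_spec
  exact h2.image_of_continuousOn ((chartMap_continuousOn T.f).mono
    fun x hx => T.f_ne (subset_closure (T.C_sub (h1 hx))))

lemma κ_sub : T.κ ⊆ T.P := by
  obtain ⟨h1, h2, -⟩ := T.cocompact.choose_spec
  rintro _ ⟨x, hx, rfl⟩
  have h3 := T.C_sub (h1 hx)
  have h4 := T.f_ne (subset_closure h3)
  exact ⟨by rw [f_chartMap h4]; exact one_pos, (chartMap_mem_lft h4).2 h3⟩

lemma zoom (x) (hx : x ∈ T.Cc) : ∃ L : (Fin d → ℝ) →ₗ[ℝ] (Fin d → ℝ), (∀ v ∈ T.P, L v ∈ T.P) ∧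
    (∀ v ∈ closure T.P, v ∉ T.P → L v ∉ T.P) ∧ (∀ v ∈ T.Z, L v ∈ T.Z) ∧ L x ∈ T.κ := by
  obtain ⟨h1, h2, h3⟩ := T.cocompact.choose_spec
  obtain ⟨hx0, hxC⟩ := hx.2
  have := h3 hxC
  simp only [mem_iUnion] at this
  obtain ⟨g, hg, k, hk, hgk⟩ := this
  have hkΩ := T.C_sub (h1 hk)
  have hfk := T.f_ne (subset_closure hkΩ)
  have hxl : g (g⁻¹ x) ∈ lft (pact g '' {k}) := by
    rw [apply_inv']; exact ⟨hx0, k, rfl, hgk⟩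
  obtain ⟨hy0, hy⟩ := lft_image_pact.1 hxl
  rw [mem_singleton_iff] at hy
  have hfy : T.f (g⁻¹ x) ≠ 0 := by
    rw [← f_rep_ne hy0, hy]; exact hfk
  have hcm : (T.f (g⁻¹ x))⁻¹ • g⁻¹ x = chartMap T.f k := by rw [← hy, chartMap_mk]
  set c := (T.f (g⁻¹ x))⁻¹ with hc
  have hc0 : c ≠ 0 := inv_ne_zero hfy
  have hκ : c • g⁻¹ x ∈ T.κ := hcm ▸ ⟨k, hk, rfl⟩
  have hg' := T.Λ.inv_mem hg
  have hPP : ∀ v ∈ T.P, c • g⁻¹ v ∈ T.P := fun v hv =>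
    T.P_inv hg' hc0 (T.Cc_sub hx) (T.κ_sub hκ).1 hv
  refine ⟨c • (g⁻¹ : (Fin d → ℝ) ≃ₗ[ℝ] (Fin d → ℝ)).toLinearMap, hPP, ?_, ?_, hκ⟩
  · intro v hv hn hcon
    have h5 : g⁻¹ v ∈ lft T.Ω := (lft_smul_iff hc0).1 hcon.2
    have h6 := T.Ω_inv hg h5
    rw [apply_inv'] at h6
    exact hn ⟨T.K_pos hv h6.1, h6⟩
  · intro v hv
    refine map_mem_closure (f := fun u => c • g⁻¹ u) ((cont_g g⁻¹).const_smul c) hv fun u hu => ?_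
    exact ⟨(hPP u (T.Cc_sub hu)).1, lft_smul hc0 (T.C_inv hg' hu.2)⟩

def toAb (hdim : ∀ x ∈ closure T.Ω \ T.Ω, (face T.Ω x ∩ closure (coreC T.Ω T.Λ)).Nonempty →
      pdim (face T.Ω x) ≤ 1) : Ab d where
  P := T.P
  Z := T.Z
  Cc := T.Cc
  κ := T.κ
  f := T.f
  R := T.R
  P_open := T.P_open
  P_ne := T.P_ne
  P_add := T.P_add
  P_smul := T.P_smul
  P_bd := T.P_bd
  P_pos := fun _ h => h.1
  Z_closed := isClosed_closure
  Z_sub := T.Z_sub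
  Z_add := fun _ hx _ hy => map_mem_closure₂
    (by fun_prop : Continuous fun p : (Fin d → ℝ) × (Fin d → ℝ) => p.1 + p.2) hx hy T.Cc_add
  Z_smul := fun c hc _ hx => map_mem_closure (continuous_const_smul c) hx (T.Cc_smul c hc)
  κ_cpt := T.κ_cpt
  κ_sub := T.κ_sub
  D := T.D hdim
  zoom := T.zoom

end CCSetup


lemma simplex_data {S : Set (PSpace d)} (hS : IsSimplexOfDim 2 S) :
    ∃ G : (Fin 3 → ℝ) →ₗ[ℝ] (Fin d → ℝ), Function.Injective G ∧
      ∀ u, u ∈ lft S ↔ ∃ a : ℝ, a ≠ 0 ∧ ∃ c : Fin 3 → ℝ, (∀ i, 0 < c i) ∧ u = a • G c := by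
  obtain ⟨h3, g, hg⟩ := hS
  let X : (Fin 3 → ℝ) →ₗ[ℝ] (Fin d → ℝ) :=
    { toFun := fun c j => if h : (j : ℕ) < 3 then c ⟨j, h⟩ else 0
      map_add' := by intro c c'; ext j; by_cases h : (j : ℕ) < 3 <;> simp [h]
      map_smul' := by intro a c; ext j; by_cases h : (j : ℕ) < 3 <;> simp [h] }
  have hX : ∀ (c : Fin 3 → ℝ) (i : Fin 3), X c (Fin.castLE h3 i) = c i := by
    intro c i
    have : ((Fin.castLE h3 i : Fin d) : ℕ) < 3 := i.2
    change (if h : ((Fin.castLE h3 i : Fin d) : ℕ) < 3 then c ⟨_, h⟩ else 0) = c i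
    rw [dif_pos this]
    rfl
  have hXi : Function.Injective X := by
    intro c c' h
    ext i
    rw [← hX c i, h, hX]
  have hcone : ∀ w, w ∈ simplexCone (d := d) 3 ↔ ∃ c : Fin 3 → ℝ, (∀ i, 0 < c i) ∧ w = X c := by
    intro w
    constructor
    · rintro ⟨h1, h2⟩
      refine ⟨fun i => w (Fin.castLE h3 i), fun i => h1 _ i.2, ?_⟩
      ext j
      change _ = if h : (j : ℕ) < 3 then w (Fin.castLE h3 ⟨j, h⟩) else 0
      split_ifs with h
      · rfl
      · exact h2 j (by omega)
    · rintro ⟨c, hc, rfl⟩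
      refine ⟨fun j hj => ?_, fun j hj => ?_⟩
      · have := hX c ⟨j, hj⟩
        have e : (Fin.castLE h3 ⟨j, hj⟩ : Fin d) = j := rfl
        rw [e] at this
        rw [this]; exact hc _
      · exact dif_neg (by omega)
  refine ⟨g.toLinearMap ∘ₗ X, g.injective.comp hXi, fun u => ?_⟩
  constructor
  · rintro ⟨hu, hmem⟩
    rw [hg] at hmem
    obtain ⟨w, hw, hw0, he⟩ := hmem
    rw [Projectivization.mk_eq_mk_iff'] at he
    obtain ⟨a, ha⟩ := he
    obtain ⟨c, hc, rfl⟩ := (hcone w).1 hw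
    refine ⟨a, ?_, c, hc, ha.symm⟩
    rintro rfl
    exact hu (by rw [← ha, zero_smul])
  · rintro ⟨a, ha, c, hc, rfl⟩
    have hc0 : X c ≠ 0 := by
      intro h
      have := hX c 0
      rw [h] at this
      exact (hc 0).ne this
    have hg0 : g (X c) ≠ 0 := by simpa using hc0
    refine lft_smul ha ⟨hg0, ?_⟩
    rw [hg]
    exact ⟨X c, (hcone _).2 ⟨c, hc, rfl⟩, hc0, rfl⟩

lemma main_aux {d : ℕ} (T : CCSetup d)
    (hdim : ∀ x ∈ closure T.Ω \ T.Ω, (face T.Ω x ∩ closure (coreC T.Ω T.Λ)).Nonempty →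
      pdim (face T.Ω x) ≤ 1)
    (a b : PSpace d) (ha : a ∈ closure T.Ω) (hb : b ∈ closure T.Ω)
    (ℓ : Set (PSpace d)) (hℓ : ℓ = projSeg T.Ω a b)
    (hℓsub : ℓ ⊆ idealBdry (coreC T.Ω T.Λ))
    (S : Set (PSpace d)) (hSsub : S ⊆ coreC T.Ω T.Λ)
    (hSpe : IsProperlyEmbedded S (coreC T.Ω T.Λ))
    (hmeet : (ℓ ∩ (closure S \ S)).Nonempty)
    (G : (Fin 3 → ℝ) →ₗ[ℝ] (Fin d → ℝ)) (hG : Function.Injective G)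
    (hGS : ∀ u, u ∈ lft S ↔ ∃ a : ℝ, a ≠ 0 ∧ ∃ c : Fin 3 → ℝ, (∀ i, 0 < c i) ∧ u = a • G c)
    (hG1 : 0 < T.f (G 1)) :
    ℓ ⊆ closure S \ S := by
  have hGc : Continuous G := G.continuous_of_finiteDimensional
  have hGl : ∀ c : Fin 3 → ℝ, (∀ i, 0 < c i) → G c ∈ lft S := fun c hc =>
    (hGS _).2 ⟨1, one_ne_zero, c, hc, by rw [one_smul]⟩
  have hfpos : ∀ c : Fin 3 → ℝ, (∀ i, 0 < c i) → 0 < T.f (G c) := by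
    intro c hc
    refine sign_lemma (f := T.f) (A := G '' {c : Fin 3 → ℝ | ∀ i, 0 < c i}) ?_ ?_ (a := G 1)
      ⟨1, fun i => one_pos, rfl⟩ hG1 ⟨c, hc, rfl⟩
    · refine Convex.linear_image ?_ G
      rw [convex_iff_forall_pos]
      intro x hx y hy s t hs ht _ i
      exact add_pos (mul_pos hs (hx i)) (mul_pos ht (hy i))
    · rintro _ ⟨c, hc, rfl⟩
      exact T.f_ne' (lft_mono (hSsub.trans (T.C_sub.trans subset_closure)) (hGl c hc))
  have hCc : ∀ c : Fin 3 → ℝ, (∀ i, 0 < c i) → G c ∈ T.Cc := fun c hc =>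
    ⟨hfpos c hc, lft_mono hSsub (hGl c hc)⟩
  have hlim : ∀ c : Fin 3 → ℝ, (∀ i, 0 ≤ c i) →
      G c ∈ closure (G '' {c : Fin 3 → ℝ | ∀ i, 0 < c i}) := by
    intro c hc
    have h1 : Tendsto (fun n : ℕ => G (c + (1 / ((n : ℝ) + 1)) • (1 : Fin 3 → ℝ))) atTop
        (nhds (G (c + (0 : ℝ) • (1 : Fin 3 → ℝ)))) :=
      (hGc.tendsto _).comp
        ((tendsto_one_div_add_atTop_nhds_zero_nat.smul_const (1 : Fin 3 → ℝ)).const_add c)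
    rw [zero_smul, add_zero] at h1
    refine mem_closure_of_tendsto h1 (Eventually.of_forall fun n => ⟨_, fun i => ?_, rfl⟩)
    have h2 : (0 : ℝ) < 1 / ((n : ℝ) + 1) := by positivity
    have h3 := hc i
    simp only [Pi.add_apply, Pi.smul_apply, Pi.one_apply, smul_eq_mul, mul_one]
    linarith
  have hclS : ∀ c : Fin 3 → ℝ, (∀ i, 0 ≤ c i) → G c ∈ closure (lft S) := fun c hc =>
    closure_mono (by rintro _ ⟨c, hc, rfl⟩; exact hGl c hc) (hlim c hc)
  have hnS : ∀ c : Fin 3 → ℝ, (∃ i, c i = 0) → G c ∉ lft S := by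
    rintro c ⟨i, hi⟩ h
    obtain ⟨r, hr, c', hc', he⟩ := (hGS _).1 h
    rw [← map_smul] at he
    have := congrFun (hG he) i
    rw [hi] at this
    exact mul_ne_zero hr (hc' i).ne' this.symm
  have hprop : closure S ∩ T.C ⊆ S := by
    obtain ⟨hsub, hp⟩ := hSpe
    have hcl := hp.isClosedMap.isClosed_range
    rintro x ⟨hx, hxC⟩
    have : (⟨x, hxC⟩ : T.C) ∈ range (inclusion hsub) := by
      rw [← hcl.closure_eq, closure_subtype]
      refine closure_mono ?_ hx
      intro s hs
      exact ⟨⟨s, hsub hs⟩, ⟨⟨s, hs⟩, rfl⟩, rfl⟩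
    obtain ⟨⟨s, hs⟩, he⟩ := this
    have : s = x := congrArg Subtype.val he
    exact this ▸ hs
  have hsum : ∀ c : Fin 3 → ℝ, ∑ i, c i • G (Pi.single i 1) = G c := by
    intro c
    conv_rhs => rw [← Finset.univ_sum_single c]
    rw [map_sum]
    refine Finset.sum_congr rfl fun i _ => ?_
    rw [← map_smul, ← Pi.single_smul, smul_eq_mul, mul_one]
  have hv : LinearIndependent ℝ (fun i : Fin 3 => G (Pi.single i 1)) := by
    rw [Fintype.linearIndependent_iff]
    intro c hc i
    rw [hsum] at hc
    rw [hG (hc.trans (map_zero G).symm)]; rfl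
  obtain ⟨Y, hYℓ, hYS, -⟩ := hmeet
  have hℓΩ : ∀ Q ∈ ℓ, Q ∈ closure T.Ω := by
    intro Q hQ; rw [hℓ] at hQ; exact hQ.1
  have hℓs : ∀ Q ∈ ℓ, cmap T.Ω Q ∈ segment ℝ (cmap T.Ω a) (cmap T.Ω b) := by
    intro Q hQ; rw [hℓ] at hQ; exact hQ.2
  set y := cmap T.Ω Y with hy
  have hyK := T.cmap_K (hℓΩ Y hYℓ)
  have hycone : ∃ c : Fin 3 → ℝ, (∀ i, 0 ≤ c i) ∧ (∃ i, 0 < c i) ∧ G c = y := by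
    have hyl : y ∈ lft (closure S) := (chartMap_mem_lft (T.f_ne (hℓΩ Y hYℓ))).2 hYS
    have h1 := T.mem_closure_pos ((lft_closure hyl.1).1 hyl) (by rw [hyK.2]; exact one_pos)
    have hcl : IsClosed (G '' {c : Fin 3 → ℝ | ∀ i, 0 ≤ c i}) := by
      refine (LinearMap.isClosedEmbedding_of_injective (LinearMap.ker_eq_bot.2 hG)).isClosedMap _ ?_
      simp only [setOf_forall]
      exact isClosed_iInter fun i => isClosed_le continuous_const (continuous_apply i)
    have h2 : y ∈ G '' {c : Fin 3 → ℝ | ∀ i, 0 ≤ c i} := by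
      refine closure_minimal ?_ hcl h1
      rintro u ⟨hu, hul⟩
      obtain ⟨r, hr, c, hc, rfl⟩ := (hGS _).1 hul
      rw [map_smul, smul_eq_mul] at hu
      have hr0 : 0 < r := pos_of_mul_pos_left hu (hfpos c hc).le
      exact ⟨r • c, fun i => (mul_pos hr0 (hc i)).le, map_smul _ _ _⟩
    obtain ⟨c, hc, he⟩ := h2
    refine ⟨c, hc, ?_, he⟩
    by_contra hcon
    push Not at hcon
    have : c = 0 := funext fun i => le_antisymm (hcon i) (hc i)
    rw [this, map_zero] at he
    exact hyl.1 he.symm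
  intro Q hQ
  set q := cmap T.Ω Q with hq
  have hqK := T.cmap_K (hℓΩ Q hQ)
  have hyq : ∀ s t : ℝ, 0 ≤ s → 0 ≤ t → 0 < s + t →
      s • y + t • q ∈ T.Z ∧ s • y + t • q ∉ T.P := by
    intro s t hs ht hst
    set z := (s + t)⁻¹ • (s • y + t • q) with hz
    have hzK : z ∈ T.K := T.K_smul (inv_nonneg.2 hst.le)
      (T.K_add (T.K_smul hs hyK.1) (T.K_smul ht hqK.1))
    have hfz : T.f z = 1 := by
      rw [hz, map_smul, map_add, map_smul, map_smul, hyK.2, hqK.2, smul_eq_mul, smul_eq_mul,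
        smul_eq_mul, mul_one, mul_one, inv_mul_cancel₀ hst.ne']
    have hz0 : z ≠ 0 := ne_of_f (f := T.f) (by rw [hfz]; exact one_ne_zero)
    have hzs : z ∈ segment ℝ (cmap T.Ω a) (cmap T.Ω b) := by
      have := convex_segment (𝕜 := ℝ) (cmap T.Ω a) (cmap T.Ω b) (hℓs Y hYℓ) (hℓs Q hQ)
        (a := (s + t)⁻¹ * s) (b := (s + t)⁻¹ * t) (by positivity) (by positivity)
        (by rw [← mul_add, inv_mul_cancel₀ hst.ne'])
      rw [hz, smul_add, smul_smul, smul_smul]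
      exact this
    have hzΩ := T.K_lft hzK hz0
    have hzℓ : Projectivization.mk ℝ z hz0 ∈ ℓ := by
      rw [hℓ]
      refine ⟨hzΩ.2, ?_⟩
      rw [cmap, chartMap_mk]
      change (T.f z)⁻¹ • z ∈ _
      rw [hfz, inv_one, one_smul]
      exact hzs
    obtain ⟨hz1, hz2⟩ := hℓsub hzℓ
    have hzZ : z ∈ T.Z := T.lft_Z ⟨hz0, hz1⟩ (by rw [hfz]; exact one_pos)
    have hzP : z ∉ T.P := fun h => hz2 (T.C_closed h ((lft_closure hz0).1 ⟨hz0, hz1⟩)).2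
    have he : s • y + t • q = (s + t) • z := by
      rw [hz, smul_smul, mul_inv_cancel₀ hst.ne', one_smul]
    refine ⟨?_, fun h => hzP (T.P_smul _ (inv_pos.2 hst) _ h)⟩
    rw [he]
    exact (T.toAb hdim).Z_smul _ hst _ hzZ
  obtain ⟨c, hc, hc0, he⟩ := Ab.main (T.toAb hdim) (v := fun i : Fin 3 => G (Pi.single i 1)) hv
    (by intro c hc; rw [hsum]; exact hCc c hc)
    (by intro c hc; rw [hsum]; exact T.Cc_sub (hCc c hc))
    (by
      intro c hc _
      rw [hsum]
      exact closure_mono (by rintro _ ⟨c, hc, rfl⟩; exact hCc c hc) (hlim c hc))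
    (by
      intro c hc h0 hP
      rw [hsum] at hP
      have hcl := hclS c hc
      have hC := T.C_closed hP (closure_mono (lft_mono hSsub) hcl)
      exact hnS c h0 ⟨hC.1, hprop ⟨((lft_closure hC.1).2 hcl).2, hC.2⟩⟩)
    (y := y) (q := q)
    (by
      obtain ⟨c, h1, h2, h3⟩ := hycone
      exact ⟨c, h1, h2, by rw [hsum, h3]⟩)
    hyq
  rw [hsum] at he
  have hfQ := T.f_ne (hℓΩ Q hQ)
  have hq0 : q ≠ 0 := chartMap_ne hfQ
  constructor
  · refine (chartMap_mem_lft hfQ).1 ((lft_closure hq0).2 ?_)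
    rw [← he]; exact hclS c hc
  · intro hQS
    have : q ∈ lft S := (chartMap_mem_lft hfQ).2 hQS
    rw [← he] at this
    exact hnS c hc0 this


/-- Lemma 6.2: under the assumption that all boundary faces meeting
`closure C_Ω(Λ)` have dimension at most one, a line segment in `∂_i C_Ω(Λ)` meeting the
boundary of a properly embedded two-dimensional simplex is contained in it. -/
theorem segment_meeting_simplex_boundary {d : ℕ} (T : CCSetup d)
    (hdim : ∀ x ∈ closure T.Ω \ T.Ω, (face T.Ω x ∩ closure (coreC T.Ω T.Λ)).Nonempty →
      pdim (face T.Ω x) ≤ 1)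
    (a b : PSpace d) (ha : a ∈ closure T.Ω) (hb : b ∈ closure T.Ω)
    (ℓ : Set (PSpace d)) (hℓ : ℓ = projSeg T.Ω a b)
    (hℓsub : ℓ ⊆ idealBdry (coreC T.Ω T.Λ))
    (S : Set (PSpace d)) (hS : IsSimplexOfDim 2 S) (hSsub : S ⊆ coreC T.Ω T.Λ)
    (hSpe : IsProperlyEmbedded S (coreC T.Ω T.Λ))
    (hmeet : (ℓ ∩ (closure S \ S)).Nonempty) :
    ℓ ⊆ closure S \ S := by
  obtain ⟨G, hG, hGS⟩ := simplex_data hS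
  have h1 : G 1 ∈ lft S := (hGS _).2 ⟨1, one_ne_zero, 1, fun _ => one_pos, by rw [one_smul]⟩
  have h2 : T.f (G 1) ≠ 0 :=
    T.f_ne' (lft_mono (hSsub.trans (T.C_sub.trans subset_closure)) h1)
  rcases lt_or_gt_of_ne h2 with h | h
  · refine main_aux T hdim a b ha hb ℓ hℓ hℓsub S hSsub hSpe hmeet (-G) ?_ ?_ ?_
    · intro x y hxy
      exact hG (neg_injective hxy)
    · intro u
      rw [hGS]
      constructor
      · rintro ⟨r, hr, c, hc, rfl⟩
        exact ⟨-r, neg_ne_zero.2 hr, c, hc, by simp⟩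
      · rintro ⟨r, hr, c, hc, rfl⟩
        exact ⟨-r, neg_ne_zero.2 hr, c, hc, by simp⟩
    · rw [LinearMap.neg_apply, map_neg]
      linarith
  · exact main_aux T hdim a b ha hb ℓ hℓ hℓsub S hSsub hSpe hmeet G hG hGS h

end Paper
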